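/- If N ≥ 5, then ‖(ℓ_1,ℓ_2)‖_{**} ≤ C(μ^{-2} + |μx|^β μ^{-(β-τ+1)}) for a constant C > 0 independent of (x, μ, L) in the admissible range, where β = min{β_1,β_2}. -/

import Mathlib

open Real MeasureTheory Filter Topology
open scoped Classical

noncomputable section

namespace PeriodicCriticalSystem

/-- Euclidean space `ℝ^N`. -/
abbrev Euc (N : ℕ) : Type := EuclideanSpace ℝ (Fin N)

/-- The `i`-th standard coordinate vector `e_i`. -/
def e (N : ℕ) (i : Fin N) : Euc N := EuclideanSpace.single i 1

/-- The strip `Ω = {y : |y_i| ≤ L/2, i = 1,…,k}`. -/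
def strip (N k : ℕ) (L : ℝ) : Set (Euc N) :=
  {y : Euc N | ∀ i : Fin N, (i : ℕ) < k → |y i| ≤ L / 2}

/-- The `i`-th partial derivative. -/
def pd {N : ℕ} (i : Fin N) (u : Euc N → ℝ) (y : Euc N) : ℝ := fderiv ℝ u y (e N i)

/-- The Laplacian `Δu = Σ_i ∂²u/∂y_i²`. -/
def lap {N : ℕ} (u : Euc N → ℝ) (y : Euc N) : ℝ :=
  ∑ i : Fin N, iteratedDeriv 2 (fun t : ℝ => u (y + t • e N i)) 0

/-- The norm `|y''|` of the last `N - k` coordinates. -/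
def tailNorm {N : ℕ} (k : ℕ) (y : Euc N) : ℝ :=
  Real.sqrt (∑ i : Fin N, if k ≤ (i : ℕ) then (y i) ^ 2 else 0)

/-- The periodic boundary conditions on the strip, together with decay as `|y''| → ∞`. -/
structure PeriodicBC (N k : ℕ) (L : ℝ) (u : Euc N → ℝ) : Prop where
  per : ∀ i : Fin N, (i : ℕ) < k → ∀ y : Euc N, y i = -(L / 2) → u (y + L • e N i) = u y
  per_deriv : ∀ i : Fin N, (i : ℕ) < k → ∀ y : Euc N, y i = -(L / 2) →
    pd i u (y + L • e N i) = pd i u y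
  decay : ∀ ε : ℝ, 0 < ε → ∃ R : ℝ, ∀ y ∈ strip N k L, R ≤ tailNorm k y → |u y| < ε

/-- The critical Sobolev exponent `2* = 2N/(N-2)`. -/
def tS (N : ℕ) : ℝ := 2 * (N : ℝ) / ((N : ℝ) - 2)

/-- Conditions (A₁) and (A₂) on a coefficient function `K`. -/
structure CondA (N k : ℕ) (K : Euc N → ℝ) (a β : Fin N → ℝ) (βm βM σ : ℝ) : Prop where
  periodic : ∀ i : Fin N, (i : ℕ) < k → ∀ y : Euc N, K (y + e N i) = K y
  bounded : ∃ M : ℝ, ∀ y : Euc N, |K y| ≤ M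
  a_ne : ∀ i : Fin N, a i ≠ 0
  β_gt : ∀ i : Fin N, (N : ℝ) - 2 < β i
  β_lt : ∀ i : Fin N, β i < (N : ℝ)
  βm_le : ∀ i : Fin N, βm ≤ β i
  βm_mem : ∃ i : Fin N, β i = βm
  le_βM : ∀ i : Fin N, β i ≤ βM
  βM_mem : ∃ i : Fin N, β i = βM
  βM_le : βM ≤ βm * (1 + 1 / ((N : ℝ) - 2))
  σ_pos : 0 < σ
  expansion : ∃ δ C : ℝ, 0 < δ ∧ 0 < C ∧ ∀ x : Euc N, ‖x‖ < δ →
    |K x - 1 - ∑ i : Fin N, a i * |x i| ^ (β i)| ≤ C * ‖x‖ ^ (βM + σ)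
  neg_sum : (∑ i ∈ Finset.univ.filter (fun i => β i = βm), a i) < 0

/-- The standard bubble `W_{x,μ}`. -/
def Wb (N : ℕ) (x : Euc N) (μ : ℝ) (y : Euc N) : ℝ :=
  ((N : ℝ) * ((N : ℝ) - 2)) ^ (((N : ℝ) - 2) / 4) * μ ^ (((N : ℝ) - 2) / 2) /
    (1 + μ ^ 2 * ‖y - x‖ ^ 2) ^ (((N : ℝ) - 2) / 2)

/-- The synchronized bubble `U_{x,μ} = s W_{x,μ}`. -/
def Ub (N : ℕ) (s : ℝ) (x : Euc N) (μ : ℝ) (y : Euc N) : ℝ := s * Wb N x μ y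

/-- The synchronized bubble `V_{x,μ} = κ s W_{x,μ}`. -/
def Vb (N : ℕ) (s κ : ℝ) (x : Euc N) (μ : ℝ) (y : Euc N) : ℝ := κ * s * Wb N x μ y

/-- The algebraic relations defining the synchronization constants `s` and `κ`. -/
def SyncConst (N : ℕ) (s κ : ℝ) : Prop :=
  0 < s ∧ 0 < κ ∧ s ^ (tS N - 2) = 2 / (2 + κ ^ (tS N / 2)) ∧
    2 + κ ^ (tS N / 2) - κ ^ (tS N / 2 - 1) - 2 * κ ^ (tS N - 1) = 0

/-- The lattice `Q_k` of integer points in the first `k` coordinates. -/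
def Qlat (N k : ℕ) : Set (Euc N) :=
  {y : Euc N | (∀ i : Fin N, ∃ m : ℤ, y i = (m : ℝ)) ∧ ∀ i : Fin N, k ≤ (i : ℕ) → y i = 0}

/-- `P` enumerates the lattice `Q_k` with `P 0 = 0`. -/
def LatticeEnum (N k : ℕ) (P : ℕ → Euc N) : Prop :=
  Function.Injective P ∧ Set.range P = Qlat N k ∧ P 0 = 0

/-- The area `ω_{N-1}` of the unit sphere `S^{N-1}`. -/
def sphereArea (N : ℕ) : ℝ := (N : ℝ) * (volume (Metric.ball (0 : Euc N) 1)).toReal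

/-- The fundamental solution `Γ(y,z)` of `-Δ`. -/
def Γfun (N : ℕ) (y z : Euc N) : ℝ :=
  1 / (((N : ℝ) - 2) * sphereArea N * ‖y - z‖ ^ ((N : ℝ) - 2))

/-- The Green's function of `-Δ` on the strip with periodic boundary conditions. -/
def Green (N : ℕ) (L : ℝ) (P : ℕ → Euc N) (y z : Euc N) : ℝ :=
  ∑' j : ℕ, Γfun N (y + L • P j) z

/-- The projected bubble `PU_{x,μ}`. -/
def PU (N k : ℕ) (L : ℝ) (P : ℕ → Euc N) (s κ : ℝ) (x : Euc N) (μ : ℝ) (y : Euc N) : ℝ :=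
  ∫ z in strip N k L, Green N L P y z *
    (Ub N s x μ z ^ (tS N - 1) +
      (1 / 2) * Ub N s x μ z ^ (tS N / 2 - 1) * Vb N s κ x μ z ^ (tS N / 2))

/-- The projected bubble `PV_{x,μ}`. -/
def PV (N k : ℕ) (L : ℝ) (P : ℕ → Euc N) (s κ : ℝ) (x : Euc N) (μ : ℝ) (y : Euc N) : ℝ :=
  ∫ z in strip N k L, Green N L P y z *
    (Vb N s κ x μ z ^ (tS N - 1) +
      (1 / 2) * Vb N s κ x μ z ^ (tS N / 2 - 1) * Ub N s x μ z ^ (tS N / 2))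

/-- The translated centers `x_j = x - L P_j`. -/
def xc {N : ℕ} (L : ℝ) (P : ℕ → Euc N) (x : Euc N) (j : ℕ) : Euc N := x - L • P j

/-- The extra weight `σ(y)`. -/
def σw {N : ℕ} (x : Euc N) (μ τ : ℝ) (y : Euc N) : ℝ :=
  min 1 (((1 + μ * ‖y - x‖) / μ) ^ (τ - 1))

/-- The weight defining the `*` norm. -/
def wStar (N : ℕ) (L : ℝ) (P : ℕ → Euc N) (x : Euc N) (μ τ : ℝ) (y : Euc N) : ℝ :=
  σw x μ τ y *
    ∑' j : ℕ, μ ^ (((N : ℝ) - 2) / 2) / (1 + μ * ‖y - xc L P x j‖) ^ (((N : ℝ) - 2) / 2 + τ)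

/-- The weight defining the `**` norm. -/
def wStarStar (N : ℕ) (L : ℝ) (P : ℕ → Euc N) (x : Euc N) (μ τ : ℝ) (y : Euc N) : ℝ :=
  σw x μ τ y *
    ∑' j : ℕ, μ ^ (((N : ℝ) + 2) / 2) / (1 + μ * ‖y - xc L P x j‖) ^ (((N : ℝ) + 2) / 2 + τ)

/-- The `*` norm. -/
def normStar (N k : ℕ) (L : ℝ) (P : ℕ → Euc N) (x : Euc N) (μ τ : ℝ) (u : Euc N → ℝ) : ℝ :=
  sSup ((fun y => |u y| / wStar N L P x μ τ y) '' strip N k L)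

/-- The `**` norm. -/
def normStarStar (N k : ℕ) (L : ℝ) (P : ℕ → Euc N) (x : Euc N) (μ τ : ℝ) (f : Euc N → ℝ) : ℝ :=
  sSup ((fun y => |f y| / wStarStar N L P x μ τ y) '' strip N k L)

/-- Finiteness of the `*` norm. -/
def FiniteStar (N k : ℕ) (L : ℝ) (P : ℕ → Euc N) (x : Euc N) (μ τ : ℝ) (u : Euc N → ℝ) : Prop :=
  BddAbove ((fun y => |u y| / wStar N L P x μ τ y) '' strip N k L)

/-- Finiteness of the `**` norm. -/
def FiniteStarStar (N k : ℕ) (L : ℝ) (P : ℕ → Euc N) (x : Euc N) (μ τ : ℝ)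
    (f : Euc N → ℝ) : Prop :=
  BddAbove ((fun y => |f y| / wStarStar N L P x μ τ y) '' strip N k L)

/-- Membership of a pair in the space `X`. -/
def MemX (N k : ℕ) (L : ℝ) (P : ℕ → Euc N) (x : Euc N) (μ τ : ℝ) (u v : Euc N → ℝ) : Prop :=
  PeriodicBC N k L u ∧ PeriodicBC N k L v ∧
    FiniteStar N k L P x μ τ u ∧ FiniteStar N k L P x μ τ v

/-- Membership of a pair in the space `Y`. -/
def MemY (N k : ℕ) (L : ℝ) (P : ℕ → Euc N) (x : Euc N) (μ τ : ℝ) (f g : Euc N → ℝ) : Prop :=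
  FiniteStarStar N k L P x μ τ f ∧ FiniteStarStar N k L P x μ τ g

/-- The operator `(-Δ)^{-1}` given by the Green's function. -/
def invLap (N k : ℕ) (L : ℝ) (P : ℕ → Euc N) (f : Euc N → ℝ) (y : Euc N) : ℝ :=
  ∫ z in strip N k L, Green N L P z y * f z

/-- `Y_h`: derivatives of `U_{x,μ}` in `x_h` (`h < N`) and in `μ` (`h = N+1`). -/
def Yd (N : ℕ) (s : ℝ) (x : Euc N) (μ : ℝ) (h : Fin (N + 1)) (y : Euc N) : ℝ :=
  if hh : (h : ℕ) < N then fderiv ℝ (fun x' => Ub N s x' μ y) x (e N ⟨(h : ℕ), hh⟩)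
  else deriv (fun μ' => Ub N s x μ' y) μ

/-- `Z_h`: derivatives of `V_{x,μ}`. -/
def Zd (N : ℕ) (s κ : ℝ) (x : Euc N) (μ : ℝ) (h : Fin (N + 1)) (y : Euc N) : ℝ :=
  if hh : (h : ℕ) < N then fderiv ℝ (fun x' => Vb N s κ x' μ y) x (e N ⟨(h : ℕ), hh⟩)
  else deriv (fun μ' => Vb N s κ x μ' y) μ

/-- `∂_h PU_{x,μ}`. -/
def dPU (N k : ℕ) (L : ℝ) (P : ℕ → Euc N) (s κ : ℝ) (x : Euc N) (μ : ℝ) (h : Fin (N + 1))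
    (y : Euc N) : ℝ :=
  if hh : (h : ℕ) < N then fderiv ℝ (fun x' => PU N k L P s κ x' μ y) x (e N ⟨(h : ℕ), hh⟩)
  else deriv (fun μ' => PU N k L P s κ x μ' y) μ

/-- `∂_h PV_{x,μ}`. -/
def dPV (N k : ℕ) (L : ℝ) (P : ℕ → Euc N) (s κ : ℝ) (x : Euc N) (μ : ℝ) (h : Fin (N + 1))
    (y : Euc N) : ℝ :=
  if hh : (h : ℕ) < N then fderiv ℝ (fun x' => PV N k L P s κ x' μ y) x (e N ⟨(h : ℕ), hh⟩)
  else deriv (fun μ' => PV N k L P s κ x μ' y) μ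

/-- `α(h) = 1` for `h = 1,…,N` and `α(N+1) = -1`. -/
def αe (N : ℕ) (h : Fin (N + 1)) : ℝ := if (h : ℕ) < N then 1 else -1

/-- Membership of a pair in the space `E`. -/
def MemE (N k : ℕ) (L : ℝ) (P : ℕ → Euc N) (s κ : ℝ) (x : Euc N) (μ τ : ℝ)
    (u v : Euc N → ℝ) : Prop :=
  MemX N k L P x μ τ u v ∧
    (∀ h : Fin (N + 1),
      (∫ y in strip N k L, u y * Ub N s x μ y ^ (tS N - 2) * Yd N s x μ h y) = 0) ∧
    (∀ h : Fin (N + 1),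
      (∫ y in strip N k L, v y * Vb N s κ x μ y ^ (tS N - 2) * Zd N s κ x μ h y) = 0)

/-- Membership of a pair in the space `F`. -/
def MemF (N k : ℕ) (L : ℝ) (P : ℕ → Euc N) (s κ : ℝ) (x : Euc N) (μ : ℝ)
    (f g : Euc N → ℝ) : Prop :=
  (∀ h : Fin (N + 1), (∫ y in strip N k L, f y * dPU N k L P s κ x μ h y) = 0) ∧
  (∀ h : Fin (N + 1), (∫ y in strip N k L, g y * dPV N k L P s κ x μ h y) = 0)

/-- The admissible range of the parameters `(x, μ)` relative to `L`. -/
def Admissible (N : ℕ) (θ C0 β : ℝ) (L : ℝ) (x : Euc N) (μ : ℝ) : Prop :=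
  1 ≤ μ ∧ 1 ≤ L ∧ ‖x‖ ≤ μ ^ (-(1 + θ)) ∧
    μ * L ^ (-(((N : ℝ) - 2) / (β - ((N : ℝ) - 2)))) ∈ Set.Icc (C0 / 2) (2 * C0)

/-- First component of the linearized operator. -/
def lin1 (N k : ℕ) (L : ℝ) (P : ℕ → Euc N) (s κ : ℝ) (K1 : Euc N → ℝ) (x : Euc N) (μ : ℝ)
    (ω1 ω2 : Euc N → ℝ) (y : Euc N) : ℝ :=
  K1 y * PU N k L P s κ x μ y ^ (tS N - 2) * ω1 y -
    (1 / ((N : ℝ) + 2)) * PU N k L P s κ x μ y ^ ((4 - (N : ℝ)) / ((N : ℝ) - 2)) *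
      PV N k L P s κ x μ y ^ ((N : ℝ) / ((N : ℝ) - 2)) * ω1 y -
    ((N : ℝ) / (2 * ((N : ℝ) + 2))) * PU N k L P s κ x μ y ^ (2 / ((N : ℝ) - 2)) *
      PV N k L P s κ x μ y ^ (2 / ((N : ℝ) - 2)) * ω2 y

/-- Second component of the linearized operator. -/
def lin2 (N k : ℕ) (L : ℝ) (P : ℕ → Euc N) (s κ : ℝ) (K2 : Euc N → ℝ) (x : Euc N) (μ : ℝ)
    (ω1 ω2 : Euc N → ℝ) (y : Euc N) : ℝ :=
  K2 y * PV N k L P s κ x μ y ^ (tS N - 2) * ω2 y -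
    (1 / ((N : ℝ) + 2)) * PV N k L P s κ x μ y ^ ((4 - (N : ℝ)) / ((N : ℝ) - 2)) *
      PU N k L P s κ x μ y ^ ((N : ℝ) / ((N : ℝ) - 2)) * ω2 y -
    ((N : ℝ) / (2 * ((N : ℝ) + 2))) * PV N k L P s κ x μ y ^ (2 / ((N : ℝ) - 2)) *
      PU N k L P s κ x μ y ^ (2 / ((N : ℝ) - 2)) * ω1 y

/-- First component `ℓ₁` of the error term. -/
def ell1 (N k : ℕ) (L : ℝ) (P : ℕ → Euc N) (s κ : ℝ) (K1 : Euc N → ℝ) (x : Euc N) (μ : ℝ)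
    (y : Euc N) : ℝ :=
  K1 y * PU N k L P s κ x μ y ^ (tS N - 1) - Ub N s x μ y ^ (tS N - 1) -
    (1 / 2) * (Ub N s x μ y ^ (tS N / 2 - 1) * Vb N s κ x μ y ^ (tS N / 2) -
      PU N k L P s κ x μ y ^ (tS N / 2 - 1) * PV N k L P s κ x μ y ^ (tS N / 2))

/-- Second component `ℓ₂` of the error term. -/
def ell2 (N k : ℕ) (L : ℝ) (P : ℕ → Euc N) (s κ : ℝ) (K2 : Euc N → ℝ) (x : Euc N) (μ : ℝ)
    (y : Euc N) : ℝ :=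
  K2 y * PV N k L P s κ x μ y ^ (tS N - 1) - Vb N s κ x μ y ^ (tS N - 1) -
    (1 / 2) * (Vb N s κ x μ y ^ (tS N / 2 - 1) * Ub N s x μ y ^ (tS N / 2) -
      PV N k L P s κ x μ y ^ (tS N / 2 - 1) * PU N k L P s κ x μ y ^ (tS N / 2))

/-- First component `N₁` of the higher order term. -/
def Nl1 (N k : ℕ) (L : ℝ) (P : ℕ → Euc N) (s κ : ℝ) (K1 : Euc N → ℝ) (x : Euc N) (μ : ℝ)
    (ω1 ω2 : Euc N → ℝ) (y : Euc N) : ℝ :=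
  K1 y * ((max (PU N k L P s κ x μ y + ω1 y) 0) ^ (tS N - 1) -
      PU N k L P s κ x μ y ^ (tS N - 1) -
      (tS N - 1) * PU N k L P s κ x μ y ^ (tS N - 2) * ω1 y) +
    (1 / 2) * ((PU N k L P s κ x μ y + ω1 y) ^ (2 / ((N : ℝ) - 2)) *
        (PV N k L P s κ x μ y + ω2 y) ^ ((N : ℝ) / ((N : ℝ) - 2)) -
      PU N k L P s κ x μ y ^ (2 / ((N : ℝ) - 2)) *
        PV N k L P s κ x μ y ^ ((N : ℝ) / ((N : ℝ) - 2))) -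
    (1 / ((N : ℝ) - 2)) * PU N k L P s κ x μ y ^ ((4 - (N : ℝ)) / ((N : ℝ) - 2)) *
      PV N k L P s κ x μ y ^ ((N : ℝ) / ((N : ℝ) - 2)) * ω1 y -
    ((N : ℝ) / (2 * ((N : ℝ) - 2))) * PU N k L P s κ x μ y ^ (2 / ((N : ℝ) - 2)) *
      PV N k L P s κ x μ y ^ (2 / ((N : ℝ) - 2)) * ω2 y

/-- Second component `N₂` of the higher order term. -/
def Nl2 (N k : ℕ) (L : ℝ) (P : ℕ → Euc N) (s κ : ℝ) (K2 : Euc N → ℝ) (x : Euc N) (μ : ℝ)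
    (ω1 ω2 : Euc N → ℝ) (y : Euc N) : ℝ :=
  K2 y * ((max (PV N k L P s κ x μ y + ω2 y) 0) ^ (tS N - 1) -
      PV N k L P s κ x μ y ^ (tS N - 1) -
      (tS N - 1) * PV N k L P s κ x μ y ^ (tS N - 2) * ω2 y) +
    (1 / 2) * ((PV N k L P s κ x μ y + ω2 y) ^ (2 / ((N : ℝ) - 2)) *
        (PU N k L P s κ x μ y + ω1 y) ^ ((N : ℝ) / ((N : ℝ) - 2)) -
      PV N k L P s κ x μ y ^ (2 / ((N : ℝ) - 2)) *
        PU N k L P s κ x μ y ^ ((N : ℝ) / ((N : ℝ) - 2))) -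
    (1 / ((N : ℝ) - 2)) * PV N k L P s κ x μ y ^ ((4 - (N : ℝ)) / ((N : ℝ) - 2)) *
      PU N k L P s κ x μ y ^ ((N : ℝ) / ((N : ℝ) - 2)) * ω2 y -
    ((N : ℝ) / (2 * ((N : ℝ) - 2))) * PV N k L P s κ x μ y ^ (2 / ((N : ℝ) - 2)) *
      PU N k L P s κ x μ y ^ (2 / ((N : ℝ) - 2)) * ω1 y


/-- The only admissible synchronization constant is `κ = 1`. -/
theorem SyncConst.kappa_eq_one {N : ℕ} (hN : 5 ≤ N) {s κ : ℝ} (h : SyncConst N s κ) : κ = 1 := by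
  obtain ⟨-, hκ, -, h⟩ := h
  have hN' : (5 : ℝ) ≤ N := by exact_mod_cast hN
  have hp : 1 < tS N / 2 := by
    unfold tS
    rw [div_div, lt_div_iff₀ (by nlinarith)]
    linarith
  set p := tS N / 2 with hpdef
  have e1 : κ ^ p = κ ^ (p - 1) * κ := by
    rw [← rpow_add_one hκ.ne']; congr 1; ring
  have e2 : κ ^ (tS N - 1) = κ ^ (p - 1) * κ ^ p := by
    rw [← rpow_add hκ]; congr 1; rw [hpdef]; ring
  rw [e2] at h
  have hq : 0 < κ ^ (p - 1) := by positivity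
  have hpp : 0 < κ ^ p := by positivity
  rcases lt_trichotomy κ 1 with hlt | heq | hgt
  · exfalso
    have h1 : κ ^ (p - 1) < 1 := rpow_lt_one hκ.le hlt (by linarith)
    have h2 : κ ^ p < κ := by
      rw [e1]; nlinarith
    nlinarith
  · exact heq
  · exfalso
    have h1 : 1 < κ ^ (p - 1) := one_lt_rpow hgt (by linarith)
    have h2 : κ < κ ^ p := by
      rw [e1]; nlinarith
    nlinarith

/-- The radial profile integral `∫ (1 + |w|²)^{-(N+2)/2} dw = |B_1|`. -/
theorem integral_profile {N : ℕ} (hN : 5 ≤ N) :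
    Integrable (fun w : Euc N => (1 + ‖w‖ ^ 2) ^ (-(((N : ℝ) + 2) / 2))) ∧
      ∫ w : Euc N, (1 + ‖w‖ ^ 2) ^ (-(((N : ℝ) + 2) / 2)) = sphereArea N / N := by
  have hN0 : (0 : ℝ) < N := by exact_mod_cast (by omega : 0 < N)
  have : Nontrivial (Euc N) := by
    have : Nonempty (Fin N) := ⟨⟨0, by omega⟩⟩
    infer_instance
  set g : ℝ → ℝ := fun r => r ^ N * (1 + r ^ 2) ^ (-((N : ℝ) / 2)) / N with hg
  set g' : ℝ → ℝ := fun r => r ^ (N - 1) * (1 + r ^ 2) ^ (-(((N : ℝ) + 2) / 2)) with hg'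
  have hder : ∀ r ∈ Set.Ici (0 : ℝ), HasDerivAt g (g' r) r := by
    intro r _
    have hpos : 0 < 1 + r ^ 2 := by positivity
    have h1 : HasDerivAt (fun r : ℝ => 1 + r ^ 2) (2 * r) r := by
      simpa using (hasDerivAt_pow 2 r).const_add 1
    have h2 := h1.rpow_const (p := -((N : ℝ) / 2)) (Or.inl hpos.ne')
    have h3 := ((hasDerivAt_pow N r).mul h2).div_const (N : ℝ)
    refine h3.congr_deriv ?_
    have e1 : (1 + r ^ 2) ^ (-((N : ℝ) / 2)) =
        (1 + r ^ 2) ^ (-(((N : ℝ) + 2) / 2)) * (1 + r ^ 2) := by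
      rw [← rpow_add_one hpos.ne']; congr 1; ring
    have e2 : (-((N : ℝ) / 2) - 1) = (-(((N : ℝ) + 2) / 2)) := by ring
    have e3 : r ^ N = r ^ (N - 1) * r := by
      rw [← pow_succ]; congr 1; omega
    rw [e1, e2, e3, hg']
    field_simp
    ring
  have hpos : ∀ r ∈ Set.Ioi (0 : ℝ), 0 ≤ g' r := by
    intro r hr
    have : (0 : ℝ) < r := hr
    simp only [hg']
    positivity
  have hlim : Tendsto g atTop (𝓝 (1 / N)) := by
    have h1 : Tendsto (fun r : ℝ => (r ^ 2)⁻¹ + 1) atTop (𝓝 (0 + 1)) :=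
      ((tendsto_pow_atTop (by norm_num : (2 : ℕ) ≠ 0)).inv_tendsto_atTop).add_const 1
    rw [zero_add] at h1
    have h2 := (h1.rpow_const (p := -((N : ℝ) / 2)) (Or.inl one_ne_zero)).div_const (N : ℝ)
    rw [one_rpow] at h2
    refine h2.congr' ?_
    filter_upwards [eventually_gt_atTop 0] with r hr
    simp only [hg]
    congr 1
    have : (1 + r ^ 2) = r ^ 2 * ((r ^ 2)⁻¹ + 1) := by field_simp
    rw [this, mul_rpow (by positivity) (by positivity), ← mul_assoc, ← rpow_natCast r 2,
      ← rpow_mul hr.le, ← rpow_natCast r N, ← rpow_add hr]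
    have : (N : ℝ) + (2 : ℕ) * -((N : ℝ) / 2) = 0 := by push_cast; ring
    rw [this, rpow_zero, one_mul]
  have hfr : Module.finrank ℝ (Euc N) = N := by simp
  constructor
  · have := (integrable_fun_norm_addHaar (E := Euc N) volume
      (f := fun r : ℝ => (1 + r ^ 2) ^ (-(((N : ℝ) + 2) / 2)))).2
      (by rw [hfr]; exact integrableOn_Ioi_deriv_of_nonneg' hder hpos hlim)
    exact this
  · have := integral_fun_norm_addHaar (E := Euc N) volume
      (fun r : ℝ => (1 + r ^ 2) ^ (-(((N : ℝ) + 2) / 2)))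
    rw [this, hfr]
    have h2 := integral_Ioi_of_hasDerivAt_of_nonneg' hder hpos hlim
    simp only [hg', smul_eq_mul] at h2 ⊢
    rw [h2, hg, sphereArea]
    have : (0 : ℝ) ^ N = 0 := zero_pow (by omega)
    simp [this, Measure.real]
    field_simp

theorem abs_det_smul_reflection {N : ℕ} (c : ℝ) (hc : 0 ≤ c) (K : Submodule ℝ (Euc N)) :
    |(c • (K.reflection : Euc N →L[ℝ] Euc N)).det| = c ^ N := by
  have h : (c • (K.reflection : Euc N →L[ℝ] Euc N)).det =
      LinearMap.det (c • K.reflection.toLinearMap) := rfl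
  rw [h, LinearMap.det_smul, K.det_reflection, abs_mul, abs_pow, abs_pow, abs_of_nonneg hc]
  simp

/-- Transformation of the integrand of the Newtonian potential under the inversion centred at `y`
of radius `√(1 + |y|²)`. -/
theorem inversion_integrand {N : ℕ} (y w : Euc N) (hw : w ≠ y) :
    (((√(1 + ‖y‖ ^ 2) / dist w y) ^ 2) ^ N) *
      ((‖y - EuclideanGeometry.inversion y (√(1 + ‖y‖ ^ 2)) w‖ ^ ((N : ℝ) - 2))⁻¹ *
        (1 + ‖EuclideanGeometry.inversion y (√(1 + ‖y‖ ^ 2)) w‖ ^ 2) ^ (-(((N : ℝ) + 2) / 2))) =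
    (1 + ‖y‖ ^ 2) ^ (-(((N : ℝ) - 2) / 2)) * (1 + ‖w‖ ^ 2) ^ (-(((N : ℝ) + 2) / 2)) := by
  have hB : 0 < 1 + ‖y‖ ^ 2 := by positivity
  have hR : 0 < √(1 + ‖y‖ ^ 2) := by positivity
  have hRsq : √(1 + ‖y‖ ^ 2) ^ 2 = 1 + ‖y‖ ^ 2 := sq_sqrt hB.le
  have hd : 0 < dist w y := dist_pos.2 hw
  have h1 : ‖y - EuclideanGeometry.inversion y (√(1 + ‖y‖ ^ 2)) w‖ =
      √(1 + ‖y‖ ^ 2) * (√(1 + ‖y‖ ^ 2) / dist w y) := by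
    rw [← dist_eq_norm, EuclideanGeometry.dist_center_inversion, dist_comm y w]
    ring
  have h2 : 1 + ‖EuclideanGeometry.inversion y (√(1 + ‖y‖ ^ 2)) w‖ ^ 2 =
      (√(1 + ‖y‖ ^ 2) / dist w y) ^ 2 * (1 + ‖w‖ ^ 2) := by
    have e1 : EuclideanGeometry.inversion y (√(1 + ‖y‖ ^ 2)) w =
        (√(1 + ‖y‖ ^ 2) / dist w y) ^ 2 • (w - y) + y := rfl
    have e2 : ‖w‖ ^ 2 = ‖w - y‖ ^ 2 + 2 * inner ℝ (w - y) y + ‖y‖ ^ 2 := by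
      rw [← norm_add_sq_real]; simp
    rw [e1, norm_add_sq_real, norm_smul, inner_smul_left, e2, ← dist_eq_norm]
    have e3 : (√(1 + ‖y‖ ^ 2) / dist w y) ^ 2 * dist w y ^ 2 = 1 + ‖y‖ ^ 2 := by
      rw [div_pow, hRsq]; field_simp
    set q := (√(1 + ‖y‖ ^ 2) / dist w y) ^ 2
    have e4 : ‖q‖ = q := by rw [norm_eq_abs, abs_of_nonneg (by positivity)]
    rw [e4]
    simp only [RCLike.conj_to_real]
    linear_combination (q - 1) * e3
  set p := √(1 + ‖y‖ ^ 2) / dist w y with hp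
  have hp0 : 0 < p := by positivity
  rw [h1, h2, mul_rpow hR.le hp0.le, mul_rpow (by positivity) (by positivity), mul_inv]
  have k1 : (√(1 + ‖y‖ ^ 2) ^ ((N : ℝ) - 2))⁻¹ = (1 + ‖y‖ ^ 2) ^ (-(((N : ℝ) - 2) / 2)) := by
    rw [← rpow_neg hR.le, sqrt_eq_rpow, ← rpow_mul hB.le]; congr 1; ring
  have k2 : (p ^ 2) ^ N * ((p ^ ((N : ℝ) - 2))⁻¹ * (p ^ 2) ^ (-(((N : ℝ) + 2) / 2))) = 1 := by
    rw [← rpow_neg hp0.le, ← pow_mul, ← rpow_natCast p (2 * N), ← rpow_natCast p 2,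
      ← rpow_mul hp0.le, ← rpow_add hp0, ← rpow_add hp0]
    convert rpow_zero p using 2
    push_cast; ring
  rw [k1]
  linear_combination ((1 + ‖y‖ ^ 2) ^ (-(((N : ℝ) - 2) / 2)) *
    (1 + ‖w‖ ^ 2) ^ (-(((N : ℝ) + 2) / 2))) * k2

/-- The Newtonian potential of `(1 + |z|²)^{-(N+2)/2}`. -/
theorem newton_profile {N : ℕ} (hN : 5 ≤ N) (y : Euc N) :
    Integrable (fun z : Euc N =>
      (‖y - z‖ ^ ((N : ℝ) - 2))⁻¹ * (1 + ‖z‖ ^ 2) ^ (-(((N : ℝ) + 2) / 2))) ∧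
    ∫ z : Euc N, (‖y - z‖ ^ ((N : ℝ) - 2))⁻¹ * (1 + ‖z‖ ^ 2) ^ (-(((N : ℝ) + 2) / 2)) =
      sphereArea N / N * (1 + ‖y‖ ^ 2) ^ (-(((N : ℝ) - 2) / 2)) := by
  have : Nonempty (Fin N) := ⟨⟨0, by omega⟩⟩
  have : Nontrivial (Euc N) := inferInstance
  set R := √(1 + ‖y‖ ^ 2) with hR
  have hR0 : R ≠ 0 := by positivity
  set h : Euc N → ℝ := fun z =>
    (‖y - z‖ ^ ((N : ℝ) - 2))⁻¹ * (1 + ‖z‖ ^ 2) ^ (-(((N : ℝ) + 2) / 2)) with hh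
  set f := EuclideanGeometry.inversion y R with hf
  have hs : MeasurableSet ({y}ᶜ : Set (Euc N)) := (measurableSet_singleton y).compl
  have hinj : Function.Injective f := EuclideanGeometry.inversion_injective y hR0
  have himg : f '' {y}ᶜ = {y}ᶜ := by
    rw [Set.image_compl_eq (EuclideanGeometry.inversion_bijective y hR0)]
    simp
  have hder : ∀ w ∈ ({y}ᶜ : Set (Euc N)), HasFDerivWithinAt f
      ((R / dist w y) ^ 2 • ((ℝ ∙ (w - y))ᗮ.reflection : Euc N →L[ℝ] Euc N)) {y}ᶜ w :=
    fun w hw => (EuclideanGeometry.hasFDerivAt_inversion hw).hasFDerivWithinAt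
  have hae : ({y}ᶜ : Set (Euc N)) =ᵐ[volume] Set.univ := by
    rw [ae_eq_univ, compl_compl]
    exact measure_singleton y
  have hcongr : Set.EqOn (fun w => |((R / dist w y) ^ 2 •
      ((ℝ ∙ (w - y))ᗮ.reflection : Euc N →L[ℝ] Euc N)).det| • h (f w))
      (fun w => (1 + ‖y‖ ^ 2) ^ (-(((N : ℝ) - 2) / 2)) *
        (1 + ‖w‖ ^ 2) ^ (-(((N : ℝ) + 2) / 2))) {y}ᶜ := by
    intro w hw
    simp only [smul_eq_mul]
    rw [abs_det_smul_reflection _ (by positivity)]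
    exact inversion_integrand y w hw
  obtain ⟨hi, hv⟩ := integral_profile hN
  constructor
  · have := (integrableOn_image_iff_integrableOn_abs_det_fderiv_smul volume hs hder hinj.injOn h).2
      ((hi.const_mul _).integrableOn.congr_fun hcongr.symm hs)
    rw [himg] at this
    rwa [← integrableOn_univ, ← integrableOn_congr_set_ae hae]
  · have := integral_image_eq_integral_abs_det_fderiv_smul volume hs hder hinj.injOn h
    rw [himg, setIntegral_congr_fun hs hcongr, setIntegral_congr_set hae,
      setIntegral_congr_set hae, setIntegral_univ, setIntegral_univ, integral_const_mul, hv] at this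
    rw [this, mul_comm]

theorem tS_sub_one {N : ℕ} (hN : 5 ≤ N) : tS N - 1 = ((N : ℝ) + 2) / ((N : ℝ) - 2) := by
  have hN' : (5 : ℝ) ≤ N := by exact_mod_cast hN
  have : (N : ℝ) - 2 ≠ 0 := by linarith
  unfold tS
  field_simp
  ring

theorem sphereArea_pos {N : ℕ} (hN : 5 ≤ N) : 0 < sphereArea N := by
  have hN' : (5 : ℝ) ≤ N := by exact_mod_cast hN
  have : Nonempty (Fin N) := ⟨⟨0, by omega⟩⟩
  have h : 0 < volume (Metric.ball (0 : Euc N) 1) := Metric.measure_ball_pos _ _ one_pos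
  have h' : volume (Metric.ball (0 : Euc N) 1) ≠ ⊤ := measure_ball_lt_top.ne
  exact mul_pos (by linarith) (ENNReal.toReal_pos h.ne' h')

/-- The normalizing constant of the bubble. -/
def bubbleConst (N : ℕ) : ℝ := ((N : ℝ) * ((N : ℝ) - 2)) ^ (((N : ℝ) - 2) / 4)

theorem bubbleConst_pos {N : ℕ} (hN : 5 ≤ N) : 0 < bubbleConst N := by
  have hN' : (5 : ℝ) ≤ N := by exact_mod_cast hN
  exact rpow_pos_of_pos (mul_pos (by linarith) (by linarith)) _

theorem Wb_eq {N : ℕ} (x : Euc N) (μ : ℝ) (y : Euc N) :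
    Wb N x μ y = bubbleConst N * μ ^ (((N : ℝ) - 2) / 2) *
      (1 + μ ^ 2 * ‖y - x‖ ^ 2) ^ (-(((N : ℝ) - 2) / 2)) := by
  rw [rpow_neg (by positivity), ← div_eq_mul_inv]
  rfl

theorem Wb_pos {N : ℕ} (hN : 5 ≤ N) (x : Euc N) {μ : ℝ} (hμ : 0 < μ) (y : Euc N) :
    0 < Wb N x μ y := by
  have := bubbleConst_pos hN
  rw [Wb_eq]
  positivity

theorem Wb_rpow {N : ℕ} (hN : 5 ≤ N) (x : Euc N) {μ : ℝ} (hμ : 0 < μ) (y : Euc N) :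
    Wb N x μ y ^ (tS N - 1) = bubbleConst N * (N * ((N : ℝ) - 2)) * μ ^ (((N : ℝ) + 2) / 2) *
      (1 + μ ^ 2 * ‖y - x‖ ^ 2) ^ (-(((N : ℝ) + 2) / 2)) := by
  have hN' : (5 : ℝ) ≤ N := by exact_mod_cast hN
  have hne : (N : ℝ) - 2 ≠ 0 := by linarith
  have hA : 0 < (N : ℝ) * ((N : ℝ) - 2) := mul_pos (by linarith) (by linarith)
  have hb := bubbleConst_pos hN
  rw [Wb_eq, tS_sub_one hN, mul_rpow (by positivity) (by positivity),
    mul_rpow (by positivity) (by positivity), ← rpow_mul hμ.le, ← rpow_mul (by positivity)]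
  have e1 : bubbleConst N ^ (((N : ℝ) + 2) / ((N : ℝ) - 2)) =
      bubbleConst N * (N * ((N : ℝ) - 2)) := by
    unfold bubbleConst
    rw [← rpow_mul hA.le, ← rpow_add_one hA.ne']
    congr 1
    field_simp
    ring
  rw [e1]
  congr 3 <;> field_simp

theorem Γfun_nonneg {N : ℕ} (hN : 5 ≤ N) (y z : Euc N) : 0 ≤ Γfun N y z := by
  have hN' : (5 : ℝ) ≤ N := by exact_mod_cast hN
  have h1 := sphereArea_pos hN
  have h2 : 0 < (N : ℝ) - 2 := by linarith
  unfold Γfun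
  positivity

/-- The bubble is the Newtonian potential of its critical power. -/
theorem newton_bubble {N : ℕ} (hN : 5 ≤ N) (x : Euc N) {μ : ℝ} (hμ : 0 < μ) (y : Euc N) :
    Integrable (fun z : Euc N => Γfun N y z * Wb N x μ z ^ (tS N - 1)) ∧
      ∫ z : Euc N, Γfun N y z * Wb N x μ z ^ (tS N - 1) = Wb N x μ y := by
  have hN' : (5 : ℝ) ≤ N := by exact_mod_cast hN
  have hn : 0 < (N : ℝ) - 2 := by linarith
  have hω := sphereArea_pos hN
  obtain ⟨hi, hv⟩ := newton_profile hN (μ • (y - x))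
  set h : Euc N → ℝ := fun z =>
    (‖μ • (y - x) - z‖ ^ ((N : ℝ) - 2))⁻¹ * (1 + ‖z‖ ^ 2) ^ (-(((N : ℝ) + 2) / 2)) with hh
  set c : ℝ := μ ^ ((N : ℝ) - 2) / (((N : ℝ) - 2) * sphereArea N) *
    (bubbleConst N * (N * ((N : ℝ) - 2)) * μ ^ (((N : ℝ) + 2) / 2)) with hc
  have hF : (fun z : Euc N => Γfun N y z * Wb N x μ z ^ (tS N - 1)) =
      fun z => c * h (μ • (z - x)) := by
    funext z
    have e1 : ‖μ • (y - x) - μ • (z - x)‖ = μ * ‖y - z‖ := by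
      rw [← smul_sub, norm_smul, norm_of_nonneg hμ.le]; congr 2; abel
    have e2 : ‖μ • (z - x)‖ ^ 2 = μ ^ 2 * ‖z - x‖ ^ 2 := by
      rw [norm_smul, norm_of_nonneg hμ.le, mul_pow]
    rw [Wb_rpow hN x hμ, hh]
    simp only [e1, e2]
    rw [mul_rpow hμ.le (norm_nonneg _), mul_inv, hc, Γfun, one_div, mul_inv]
    have : (μ ^ ((N : ℝ) - 2)) * (μ ^ ((N : ℝ) - 2))⁻¹ = 1 := mul_inv_cancel₀ (by positivity)
    linear_combination (-(((N : ℝ) - 2) * sphereArea N)⁻¹ * (‖y - z‖ ^ ((N : ℝ) - 2))⁻¹ *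
      (bubbleConst N * (N * ((N : ℝ) - 2)) * μ ^ (((N : ℝ) + 2) / 2) *
      (1 + μ ^ 2 * ‖z - x‖ ^ 2) ^ (-(((N : ℝ) + 2) / 2)))) * this
  rw [hF]
  constructor
  · exact (((integrable_comp_smul_iff volume h hμ.ne').2 hi).comp_sub_right x).const_mul c
  · rw [integral_const_mul, integral_sub_right_eq_self (fun z => h (μ • z)) x,
      Measure.integral_comp_smul, hv, Wb_eq, hc, norm_smul, norm_of_nonneg hμ.le, mul_pow]
    have hfr : Module.finrank ℝ (Euc N) = N := by simp
    rw [hfr, abs_of_nonneg (by positivity), smul_eq_mul, ← rpow_natCast μ N]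
    have e3 : μ ^ ((N : ℝ) - 2) * μ ^ (((N : ℝ) + 2) / 2) * (μ ^ (N : ℝ))⁻¹ =
        μ ^ (((N : ℝ) - 2) / 2) := by
      rw [← rpow_neg hμ.le, ← rpow_add hμ, ← rpow_add hμ]; congr 1; ring
    rw [← e3]
    field_simp

theorem LatticeEnum.apply_eq_zero {N k : ℕ} {P : ℕ → Euc N} (hP : LatticeEnum N k P) (j : ℕ)
    (i : Fin N) (hi : k ≤ (i : ℕ)) : P j i = 0 := by
  have h : P j ∈ Qlat N k := hP.2.1 ▸ Set.mem_range_self j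
  exact h.2 i hi

theorem LatticeEnum.exists_int {N k : ℕ} {P : ℕ → Euc N} (hP : LatticeEnum N k P) (j : ℕ)
    (i : Fin N) : ∃ m : ℤ, P j i = m := by
  have h : P j ∈ Qlat N k := hP.2.1 ▸ Set.mem_range_self j
  exact h.1 i

theorem LatticeEnum.ne_zero {N k : ℕ} {P : ℕ → Euc N} (hP : LatticeEnum N k P) {j : ℕ}
    (hj : j ≠ 0) : P j ≠ 0 := fun h => hj (hP.1 (h.trans hP.2.2.symm))

theorem LatticeEnum.one_le_norm {N k : ℕ} {P : ℕ → Euc N} (hP : LatticeEnum N k P) {j : ℕ}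
    (hj : j ≠ 0) : 1 ≤ ‖P j‖ := by
  by_contra! hlt
  apply hP.ne_zero hj
  ext i
  obtain ⟨m, hm⟩ := hP.exists_int j i
  have h1 : |P j i| < 1 := lt_of_le_of_lt (by simpa using PiLp.norm_apply_le (P j) i) hlt
  have h3 : |(m : ℝ)| < 1 := by rwa [hm] at h1
  rw [hm]
  have h2 : |m| < 1 := by exact_mod_cast h3
  simp [Int.abs_lt_one_iff.1 h2]

/-- Lattice sums with exponent larger than the rank converge. -/
theorem LatticeEnum.summable {N k : ℕ} (hkN : k ≤ N) {P : ℕ → Euc N} (hP : LatticeEnum N k P)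
    {p : ℝ} (hp : (k : ℝ) < p) : Summable fun j => ‖P j‖ ^ (-p) := by
  set Λ : Submodule ℤ (Fin k → ℝ) :=
    Submodule.span ℤ (Set.range (Pi.basisFun ℝ (Fin k))) with hΛ
  have hrank : Module.finrank ℤ Λ = k := by
    rw [ZLattice.rank ℝ Λ]; simp
  have hsum := ZLattice.summable_norm_rpow Λ (-p) (by rw [hrank]; linarith)
  let v : ℕ → Fin k → ℝ := fun j i => P j (Fin.castLE hkN i)
  have hv : ∀ j, v j ∈ Λ := by
    intro j
    rw [hΛ, (Pi.basisFun ℝ (Fin k)).mem_span_iff_repr_mem ℤ]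
    intro i
    obtain ⟨m, hm⟩ := hP.exists_int j (Fin.castLE hkN i)
    exact ⟨m, by simp [v, hm]⟩
  have hinj : Function.Injective (fun j => (⟨v j, hv j⟩ : Λ)) := by
    intro j j' h
    apply hP.1
    ext i
    by_cases hi : (i : ℕ) < k
    · exact congrFun (congrArg Subtype.val h) ⟨i, hi⟩
    · rw [hP.apply_eq_zero j i (by omega), hP.apply_eq_zero j' i (by omega)]
  have hk0 : (0 : ℝ) ≤ k := by positivity
  refine Summable.of_nonneg_of_le (fun j => by positivity) (fun j => ?_) (hsum.comp_injective hinj)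
  have hle : ‖v j‖ ≤ ‖P j‖ := (pi_norm_le_iff_of_nonneg (norm_nonneg _)).2
    fun i => PiLp.norm_apply_le (P j) _
  change ‖P j‖ ^ (-p) ≤ ‖v j‖ ^ (-p)
  by_cases hz : v j = 0
  · have : P j = 0 := by
      ext i
      by_cases hi : (i : ℕ) < k
      · exact congrFun hz ⟨i, hi⟩
      · exact hP.apply_eq_zero j i (by omega)
    rw [this, hz, norm_zero, norm_zero]
  · exact rpow_le_rpow_of_nonpos (norm_pos_iff.2 hz) hle (by linarith)

/-- Lattice translates of a point of the strip are far from the origin. -/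
theorem LatticeEnum.le_norm_add {N k : ℕ} {P : ℕ → Euc N} (hP : LatticeEnum N k P) {L : ℝ}
    (hL : 0 < L) {y : Euc N} (hy : y ∈ strip N k L) (j : ℕ) :
    L / 2 * ‖P j‖ ≤ ‖y + L • P j‖ := by
  have h1 : L / 2 * ‖P j‖ = ‖(L / 2) • P j‖ := by
    rw [norm_smul, norm_of_nonneg (by positivity)]
  rw [h1, EuclideanSpace.norm_eq, EuclideanSpace.norm_eq]
  apply sqrt_le_sqrt
  apply Finset.sum_le_sum
  intro i _
  rw [norm_eq_abs, norm_eq_abs]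
  apply pow_le_pow_left₀ (abs_nonneg _)
  simp only [PiLp.smul_apply, PiLp.add_apply, smul_eq_mul]
  by_cases hi : (i : ℕ) < k
  · have hyi := hy i hi
    obtain ⟨m, hm⟩ := hP.exists_int j i
    rw [hm]
    by_cases hm0 : m = 0
    · simp [hm0]
    · have h3 : (1 : ℝ) ≤ |(m : ℝ)| := by
        exact_mod_cast Int.one_le_abs hm0
      have h4 : |L * (m : ℝ)| ≤ |y i + L * m| + |y i| := by
        have := abs_sub (y i + L * m) (y i)
        simpa using this
      rw [abs_mul, abs_of_pos hL] at h4
      rw [abs_mul, abs_of_pos (by positivity : 0 < L / 2)]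
      nlinarith
  · rw [hP.apply_eq_zero j i (by omega)]; simp

theorem one_add_mul_norm_sub_ge {N : ℕ} {μ : ℝ} {x : Euc N} (hμ : 0 ≤ μ) (hx : μ * ‖x‖ ≤ 1)
    (z : Euc N) : μ * ‖z‖ ≤ 1 + μ * ‖z - x‖ := by
  have h : ‖z‖ ≤ ‖z - x‖ + ‖x‖ := by simpa using norm_add_le (z - x) x
  nlinarith [mul_le_mul_of_nonneg_left h hμ]

theorem sub_xc {N : ℕ} (L : ℝ) (P : ℕ → Euc N) (x y : Euc N) (j : ℕ) :
    y - xc L P x j = y + L • P j - x := by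
  unfold xc; abel

theorem LatticeEnum.xc_zero {N k : ℕ} {P : ℕ → Euc N} (hP : LatticeEnum N k P) (L : ℝ)
    (x : Euc N) : xc L P x 0 = x := by
  simp [xc, hP.2.2]

theorem LatticeEnum.weight_ge {N k : ℕ} {P : ℕ → Euc N} (hP : LatticeEnum N k P) {L μ : ℝ}
    (hL : 0 < L) (hμ : 0 < μ) {x y : Euc N} (hx : μ * ‖x‖ ≤ 1) (hy : y ∈ strip N k L) (j : ℕ) :
    μ * L / 2 * ‖P j‖ ≤ 1 + μ * ‖y - xc L P x j‖ := by
  rw [sub_xc]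
  refine le_trans ?_ (one_add_mul_norm_sub_ge hμ.le hx _)
  calc μ * L / 2 * ‖P j‖ = μ * (L / 2 * ‖P j‖) := by ring
    _ ≤ _ := mul_le_mul_of_nonneg_left (hP.le_norm_add hL hy j) hμ.le

theorem LatticeEnum.weight_rpow_le {N k : ℕ} {P : ℕ → Euc N} (hP : LatticeEnum N k P) {L μ : ℝ}
    (hL : 0 < L) (hμ : 0 < μ) {x y : Euc N} (hx : μ * ‖x‖ ≤ 1) (hy : y ∈ strip N k L)
    {p : ℝ} (hp : 0 ≤ p) (j : ℕ) :
    (1 + μ * ‖y - xc L P x (j + 1)‖) ^ (-p) ≤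
      (μ * L / 2) ^ (-p) * ‖P (j + 1)‖ ^ (-p) := by
  have h1 := hP.one_le_norm (Nat.succ_ne_zero j)
  rw [← mul_rpow (by positivity) (by positivity)]
  exact rpow_le_rpow_of_nonpos (by positivity) (hP.weight_ge hL hμ hx hy _) (by linarith)

/-- Sums of weights over the translated centres other than the first one. -/
theorem LatticeEnum.tail_sum {N k : ℕ} (hkN : k ≤ N) {P : ℕ → Euc N} (hP : LatticeEnum N k P)
    {L μ : ℝ} (hL : 0 < L) (hμ : 0 < μ) {x y : Euc N} (hx : μ * ‖x‖ ≤ 1)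
    (hy : y ∈ strip N k L) {p : ℝ} (hp : (k : ℝ) < p) :
    Summable (fun j => (1 + μ * ‖y - xc L P x j‖) ^ (-p)) ∧
    ∑' j, (1 + μ * ‖y - xc L P x (j + 1)‖) ^ (-p) ≤
      (∑' j, ‖P j‖ ^ (-p)) * (μ * L / 2) ^ (-p) := by
  have hk0 : (0 : ℝ) ≤ k := by positivity
  have hp0 : 0 ≤ p := by linarith
  have hs := hP.summable hkN hp
  have hs1 := (summable_nat_add_iff 1).2 hs
  have hb := fun j => hP.weight_rpow_le hL hμ hx hy hp0 j
  have hs2 := Summable.of_nonneg_of_le (fun j => by positivity) hb (hs1.mul_left _)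
  refine ⟨(summable_nat_add_iff 1).1 hs2, ?_⟩
  calc _ ≤ ∑' j, (μ * L / 2) ^ (-p) * ‖P (j + 1)‖ ^ (-p) := hs2.tsum_le_tsum hb (hs1.mul_left _)
    _ = (μ * L / 2) ^ (-p) * ∑' j, ‖P (j + 1)‖ ^ (-p) := tsum_mul_left
    _ ≤ (μ * L / 2) ^ (-p) * ∑' j, ‖P j‖ ^ (-p) := by
        refine mul_le_mul_of_nonneg_left ?_ (by positivity)
        rw [hs.tsum_eq_zero_add]
        have : 0 ≤ ‖P 0‖ ^ (-p) := by positivity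
        linarith
    _ = _ := mul_comm _ _

theorem Wb_le {N : ℕ} (hN : 5 ≤ N) (x : Euc N) {μ : ℝ} (hμ : 0 < μ) (y : Euc N) :
    Wb N x μ y ≤ bubbleConst N * 2 ^ (((N : ℝ) - 2) / 2) * μ ^ (((N : ℝ) - 2) / 2) *
      (1 + μ * ‖y - x‖) ^ (-((N : ℝ) - 2)) := by
  have hN' : (5 : ℝ) ≤ N := by exact_mod_cast hN
  have hb := bubbleConst_pos hN
  set d := ‖y - x‖
  have hd : 0 ≤ d := norm_nonneg _
  have h1 : (1 + μ * d) ^ 2 / 2 ≤ 1 + μ ^ 2 * d ^ 2 := by nlinarith [sq_nonneg (1 - μ * d)]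
  have h2 : (1 + μ ^ 2 * d ^ 2) ^ (-(((N : ℝ) - 2) / 2)) ≤
      ((1 + μ * d) ^ 2 / 2) ^ (-(((N : ℝ) - 2) / 2)) :=
    rpow_le_rpow_of_nonpos (by positivity) h1 (by linarith)
  have h3 : ((1 + μ * d) ^ 2 / 2) ^ (-(((N : ℝ) - 2) / 2)) =
      2 ^ (((N : ℝ) - 2) / 2) * (1 + μ * d) ^ (-((N : ℝ) - 2)) := by
    rw [div_rpow (by positivity) (by norm_num), rpow_neg (by norm_num : (0 : ℝ) ≤ 2),
      div_inv_eq_mul, mul_comm, ← rpow_natCast (1 + μ * d) 2, ← rpow_mul (by positivity)]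
    congr 2; push_cast; ring
  rw [Wb_eq]
  calc _ ≤ bubbleConst N * μ ^ (((N : ℝ) - 2) / 2) *
        (2 ^ (((N : ℝ) - 2) / 2) * (1 + μ * d) ^ (-((N : ℝ) - 2))) := by
        rw [← h3]; gcongr
    _ = _ := by ring

theorem le_Wb {N : ℕ} (hN : 5 ≤ N) (x : Euc N) {μ : ℝ} (hμ : 0 < μ) (y : Euc N) :
    bubbleConst N * μ ^ (((N : ℝ) - 2) / 2) * (1 + μ * ‖y - x‖) ^ (-((N : ℝ) - 2)) ≤
      Wb N x μ y := by
  have hN' : (5 : ℝ) ≤ N := by exact_mod_cast hN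
  have hb := bubbleConst_pos hN
  set d := ‖y - x‖ with hdd
  have hd : 0 ≤ d := norm_nonneg _
  have h1 : 1 + μ ^ 2 * d ^ 2 ≤ (1 + μ * d) ^ 2 := by nlinarith [mul_nonneg hμ.le hd]
  have h2 : ((1 + μ * d) ^ 2) ^ (-(((N : ℝ) - 2) / 2)) ≤
      (1 + μ ^ 2 * d ^ 2) ^ (-(((N : ℝ) - 2) / 2)) :=
    rpow_le_rpow_of_nonpos (by positivity) h1 (by linarith)
  have h3 : ((1 + μ * d) ^ 2) ^ (-(((N : ℝ) - 2) / 2)) = (1 + μ * d) ^ (-((N : ℝ) - 2)) := by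
    rw [← rpow_natCast (1 + μ * d) 2, ← rpow_mul (by positivity)]
    congr 1; push_cast; ring
  rw [Wb_eq, ← hdd, ← h3]
  gcongr

theorem measurableSet_strip (N k : ℕ) (L : ℝ) : MeasurableSet (strip N k L) := by
  have : strip N k L = ⋂ i : Fin N, ⋂ _ : (i : ℕ) < k, {y : Euc N | |y i| ≤ L / 2} := by
    ext; simp [strip]
  rw [this]
  refine MeasurableSet.iInter fun i => MeasurableSet.iInter fun _ => ?_
  exact (isClosed_le (by fun_prop) continuous_const).measurableSet

/-- The mass of the Newtonian potential of `W^{2*-1}` coming from outside the strip. -/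
theorem outer_potential_le {N k : ℕ} (hN : 5 ≤ N) {L μ : ℝ} (hL : 1 ≤ L) (hμ : 1 ≤ μ)
    {x : Euc N} (hx : μ * ‖x‖ ≤ 1) (y : Euc N) :
    ∫ z in (strip N k L)ᶜ, Γfun N y z * Wb N x μ z ^ (tS N - 1) ≤
      9 ^ (((N : ℝ) + 2) / 2) * bubbleConst N *
        (μ ^ (((N : ℝ) - 2) / 2) * (μ * L) ^ (-((N : ℝ) - 2))) := by
  have hN' : (5 : ℝ) ≤ N := by exact_mod_cast hN
  have hb := bubbleConst_pos hN
  have hμ0 : 0 < μ := by linarith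
  have hL0 : 0 < L := by linarith
  have hML : 1 ≤ μ * L := by nlinarith
  have hA : 0 ≤ (N : ℝ) * ((N : ℝ) - 2) := mul_nonneg (by linarith) (by linarith)
  set m : ℝ := ((N : ℝ) + 2) / 2 with hm
  obtain ⟨hi, hv⟩ := newton_bubble hN x (inv_pos.2 hL0) y
  obtain ⟨hi', -⟩ := newton_bubble hN x hμ0 y
  have hnn : ∀ z : Euc N, 0 ≤ Γfun N y z * Wb N x L⁻¹ z ^ (tS N - 1) := fun z =>
    mul_nonneg (Γfun_nonneg hN _ _) (rpow_nonneg (Wb_pos hN x (inv_pos.2 hL0) z).le _)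
  have key : ∀ z ∈ (strip N k L)ᶜ, Γfun N y z * Wb N x μ z ^ (tS N - 1) ≤
      9 ^ m * (μ * L) ^ (-m) * (Γfun N y z * Wb N x L⁻¹ z ^ (tS N - 1)) := by
    intro z hz
    have hzL : L / 2 ≤ ‖z‖ := by
      simp only [strip, Set.mem_compl_iff, Set.mem_ofPred_eq, not_forall] at hz
      obtain ⟨i, _, hzi⟩ := hz
      have h1 : |z i| ≤ ‖z‖ := by simpa using PiLp.norm_apply_le z i
      linarith
    have hz1 := one_add_mul_norm_sub_ge hμ0.le hx z
    rw [Wb_rpow hN x hμ0, Wb_rpow hN x (inv_pos.2 hL0)]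
    set d := ‖z - x‖
    have hd : 0 ≤ d := norm_nonneg _
    have h2 : μ * L ≤ 2 * (1 + μ * d) := by nlinarith
    have h3 : (μ * L) ^ 2 ≤ 8 * (1 + μ ^ 2 * d ^ 2) := by
      nlinarith [sq_nonneg (1 - μ * d), mul_nonneg hμ0.le hd]
    have h4 : (μ * L) ^ 2 / 9 * (1 + L⁻¹ ^ 2 * d ^ 2) ≤ 1 + μ ^ 2 * d ^ 2 := by
      have : (μ * L) ^ 2 / 9 * (1 + L⁻¹ ^ 2 * d ^ 2) = ((μ * L) ^ 2 + μ ^ 2 * d ^ 2) / 9 := by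
        field_simp
      rw [this]; nlinarith
    have h5 : (1 + μ ^ 2 * d ^ 2) ^ (-m) ≤ ((μ * L) ^ 2 / 9 * (1 + L⁻¹ ^ 2 * d ^ 2)) ^ (-m) :=
      rpow_le_rpow_of_nonpos (by positivity) h4 (by rw [hm]; linarith)
    have h6 : ((μ * L) ^ 2 / 9 * (1 + L⁻¹ ^ 2 * d ^ 2)) ^ (-m) * μ ^ m =
        9 ^ m * (μ * L) ^ (-m) * L⁻¹ ^ m * (1 + L⁻¹ ^ 2 * d ^ 2) ^ (-m) := by
      rw [mul_rpow (by positivity) (by positivity), div_rpow (by positivity) (by norm_num),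
        rpow_neg (by norm_num : (0 : ℝ) ≤ 9), div_inv_eq_mul, sq (μ * L),
        mul_rpow (by positivity) (by positivity), mul_rpow hμ0.le hL0.le, inv_rpow hL0.le,
        rpow_neg hμ0.le, rpow_neg hL0.le]
      have e1 : μ ^ m * (μ ^ m)⁻¹ = 1 := mul_inv_cancel₀ (by positivity)
      linear_combination (9 ^ m * (μ ^ m)⁻¹ * (L ^ m)⁻¹ * (L ^ m)⁻¹ *
        (1 + L⁻¹ ^ 2 * d ^ 2) ^ (-m)) * e1
    have hΓ := Γfun_nonneg hN y z
    calc Γfun N y z * (bubbleConst N * (N * ((N : ℝ) - 2)) * μ ^ m * (1 + μ ^ 2 * d ^ 2) ^ (-m))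
        ≤ Γfun N y z * (bubbleConst N * (N * ((N : ℝ) - 2)) * μ ^ m *
          ((μ * L) ^ 2 / 9 * (1 + L⁻¹ ^ 2 * d ^ 2)) ^ (-m)) := by gcongr
      _ = Γfun N y z * (bubbleConst N * (N * ((N : ℝ) - 2)) *
          (((μ * L) ^ 2 / 9 * (1 + L⁻¹ ^ 2 * d ^ 2)) ^ (-m) * μ ^ m)) := by ring
      _ = _ := by rw [h6]; ring
  calc ∫ z in (strip N k L)ᶜ, Γfun N y z * Wb N x μ z ^ (tS N - 1)
      ≤ ∫ z in (strip N k L)ᶜ,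
          9 ^ m * (μ * L) ^ (-m) * (Γfun N y z * Wb N x L⁻¹ z ^ (tS N - 1)) :=
        setIntegral_mono_on hi'.integrableOn (hi.const_mul _).integrableOn
          (measurableSet_strip N k L).compl key
    _ ≤ ∫ z, 9 ^ m * (μ * L) ^ (-m) * (Γfun N y z * Wb N x L⁻¹ z ^ (tS N - 1)) :=
        setIntegral_le_integral (hi.const_mul _)
          (Eventually.of_forall fun z => mul_nonneg (by positivity) (hnn z))
    _ = 9 ^ m * (μ * L) ^ (-m) * Wb N x L⁻¹ y := by rw [integral_const_mul, hv]
    _ ≤ 9 ^ m * (μ * L) ^ (-(((N : ℝ) - 2) / 2)) *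
          (bubbleConst N * L⁻¹ ^ (((N : ℝ) - 2) / 2) * 1) := by
        have h7 : (μ * L) ^ (-m) ≤ (μ * L) ^ (-(((N : ℝ) - 2) / 2)) :=
          rpow_le_rpow_of_exponent_le hML (by rw [hm]; linarith)
        rw [Wb_eq]
        have h8 : (1 + L⁻¹ ^ 2 * ‖y - x‖ ^ 2) ^ (-(((N : ℝ) - 2) / 2)) ≤ 1 :=
          rpow_le_one_of_one_le_of_nonpos (le_add_of_nonneg_right (by positivity))
            (by linarith)
        refine mul_le_mul (mul_le_mul_of_nonneg_left h7 (by positivity))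
          (mul_le_mul_of_nonneg_left h8 (by positivity)) (by positivity) (by positivity)
    _ = _ := by
        have e1 : -((N : ℝ) - 2) = -(((N : ℝ) - 2) / 2) + -(((N : ℝ) - 2) / 2) := by ring
        rw [e1, rpow_add (by positivity), mul_rpow hμ0.le hL0.le, inv_rpow hL0.le,
          rpow_neg hμ0.le, rpow_neg hL0.le]
        have e2 : μ ^ (((N : ℝ) - 2) / 2) * (μ ^ (((N : ℝ) - 2) / 2))⁻¹ = 1 :=
          mul_inv_cancel₀ (by positivity)
        field_simp

/-- The projection of the standard bubble. -/
def projW (N k : ℕ) (L : ℝ) (P : ℕ → Euc N) (x : Euc N) (μ : ℝ) (y : Euc N) : ℝ :=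
  ∫ z in strip N k L, Green N L P y z * Wb N x μ z ^ (tS N - 1)

theorem summable_Wb {N k : ℕ} (hN : 5 ≤ N) (hk : (k : ℝ) < (N : ℝ) - 2) {P : ℕ → Euc N}
    (hP : LatticeEnum N k P) {L μ : ℝ} (hL : 0 < L) (hμ : 0 < μ) {x y : Euc N}
    (hx : μ * ‖x‖ ≤ 1) (hy : y ∈ strip N k L) :
    Summable (fun j => Wb N x μ (y + L • P j)) := by
  have hkN : k ≤ N := by
    have : (k : ℝ) ≤ N := by linarith
    exact_mod_cast this
  have h := (hP.tail_sum hkN hL hμ hx hy hk).1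
  refine Summable.of_nonneg_of_le (fun j => (Wb_pos hN x hμ _).le) (fun j => ?_)
    (h.mul_left (bubbleConst N * 2 ^ (((N : ℝ) - 2) / 2) * μ ^ (((N : ℝ) - 2) / 2)))
  rw [sub_xc]
  exact Wb_le hN x hμ _

theorem tsum_Wb_le {N k : ℕ} (hN : 5 ≤ N) (hk : (k : ℝ) < (N : ℝ) - 2) {P : ℕ → Euc N}
    (hP : LatticeEnum N k P) {L μ : ℝ} (hL : 0 < L) (hμ : 0 < μ) {x y : Euc N}
    (hx : μ * ‖x‖ ≤ 1) (hy : y ∈ strip N k L) :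
    ∑' j, Wb N x μ (y + L • P j) ≤ bubbleConst N * 2 ^ (((N : ℝ) - 2) / 2) *
      (μ ^ (((N : ℝ) - 2) / 2) * ∑' j, (1 + μ * ‖y - xc L P x j‖) ^ (-((N : ℝ) - 2))) := by
  have hkN : k ≤ N := by
    have : (k : ℝ) ≤ N := by linarith
    exact_mod_cast this
  have h := (hP.tail_sum hkN hL hμ hx hy hk).1
  rw [← mul_assoc, ← tsum_mul_left]
  refine (summable_Wb hN hk hP hL hμ hx hy).tsum_le_tsum (fun j => ?_) (h.mul_left _)
  rw [sub_xc]
  exact Wb_le hN x hμ _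

theorem tail_Wb_le {N k : ℕ} (hN : 5 ≤ N) (hk : (k : ℝ) < (N : ℝ) - 2) {P : ℕ → Euc N}
    (hP : LatticeEnum N k P) {L μ : ℝ} (hL : 0 < L) (hμ : 0 < μ) {x y : Euc N}
    (hx : μ * ‖x‖ ≤ 1) (hy : y ∈ strip N k L) :
    ∑' j, Wb N x μ (y + L • P (j + 1)) ≤ bubbleConst N * 2 ^ (((N : ℝ) - 2) / 2) *
      ((∑' j, ‖P j‖ ^ (-((N : ℝ) - 2))) * 2 ^ ((N : ℝ) - 2)) *
      (μ ^ (((N : ℝ) - 2) / 2) * (μ * L) ^ (-((N : ℝ) - 2))) := by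
  have hkN : k ≤ N := by
    have : (k : ℝ) ≤ N := by linarith
    exact_mod_cast this
  have hb := bubbleConst_pos hN
  obtain ⟨h, h2⟩ := hP.tail_sum hkN hL hμ hx hy hk
  calc _ ≤ ∑' j, bubbleConst N * 2 ^ (((N : ℝ) - 2) / 2) * μ ^ (((N : ℝ) - 2) / 2) *
        (1 + μ * ‖y - xc L P x (j + 1)‖) ^ (-((N : ℝ) - 2)) := by
        refine ((summable_nat_add_iff 1).2 (summable_Wb hN hk hP hL hμ hx hy)).tsum_le_tsum
          (fun j => ?_) (((summable_nat_add_iff 1).2 h).mul_left _)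
        rw [sub_xc]
        exact Wb_le hN x hμ _
    _ = bubbleConst N * 2 ^ (((N : ℝ) - 2) / 2) * μ ^ (((N : ℝ) - 2) / 2) *
        ∑' j, (1 + μ * ‖y - xc L P x (j + 1)‖) ^ (-((N : ℝ) - 2)) := tsum_mul_left
    _ ≤ bubbleConst N * 2 ^ (((N : ℝ) - 2) / 2) * μ ^ (((N : ℝ) - 2) / 2) *
        ((∑' j, ‖P j‖ ^ (-((N : ℝ) - 2))) * (μ * L / 2) ^ (-((N : ℝ) - 2))) :=
        mul_le_mul_of_nonneg_left h2 (by positivity)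
    _ = _ := by
        rw [div_rpow (by positivity) (by norm_num), rpow_neg (by norm_num : (0 : ℝ) ≤ 2),
          div_inv_eq_mul]
        ring

theorem projW_bounds {N k : ℕ} (hN : 5 ≤ N) (hk : (k : ℝ) < (N : ℝ) - 2) {P : ℕ → Euc N}
    (hP : LatticeEnum N k P) {L μ : ℝ} (hL : 1 ≤ L) (hμ : 1 ≤ μ) {x y : Euc N}
    (hx : μ * ‖x‖ ≤ 1) (hy : y ∈ strip N k L) :
    0 ≤ projW N k L P x μ y ∧ projW N k L P x μ y ≤ ∑' j, Wb N x μ (y + L • P j) ∧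
    Wb N x μ y ≤ projW N k L P x μ y + 9 ^ (((N : ℝ) + 2) / 2) * bubbleConst N *
        (μ ^ (((N : ℝ) - 2) / 2) * (μ * L) ^ (-((N : ℝ) - 2))) := by
  have hμ0 : 0 < μ := by linarith
  have hL0 : 0 < L := by linarith
  set F : ℕ → Euc N → ℝ := fun j z => Γfun N (y + L • P j) z * Wb N x μ z ^ (tS N - 1) with hF
  have hFnn : ∀ j z, 0 ≤ F j z := fun j z =>
    mul_nonneg (Γfun_nonneg hN _ _) (rpow_nonneg (Wb_pos hN x hμ0 z).le _)
  have hnb := fun j => newton_bubble hN x hμ0 (y + L • P j)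
  have hint : ∀ j, Integrable (F j) (volume.restrict (strip N k L)) := fun j =>
    (hnb j).1.integrableOn
  have hle : ∀ j, ∫ z in strip N k L, F j z ≤ Wb N x μ (y + L • P j) := fun j => by
    rw [← (hnb j).2]
    exact setIntegral_le_integral (hnb j).1 (Eventually.of_forall (hFnn j))
  have hnn : ∀ j, 0 ≤ ∫ z in strip N k L, F j z := fun j =>
    integral_nonneg (hFnn j)
  have hsW := summable_Wb hN hk hP hL0 hμ0 hx hy
  have hsF : Summable fun j => ∫ z in strip N k L, F j z := .of_nonneg_of_le hnn hle hsW
  have hsum := hasSum_integral_of_summable_integral_norm hint (by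
    simpa only [Real.norm_of_nonneg (hFnn _ _)] using hsF)
  have hproj : projW N k L P x μ y = ∑' j, ∫ z in strip N k L, F j z := by
    rw [hsum.tsum_eq]
    unfold projW Green
    simp only [hF, tsum_mul_right]
  rw [hproj]
  refine ⟨tsum_nonneg hnn, hsF.tsum_le_tsum hle hsW, ?_⟩
  have h0 : ∫ z in strip N k L, F 0 z ≤ ∑' j, ∫ z in strip N k L, F j z :=
    hsF.le_tsum 0 fun j _ => hnn j
  have hPz : y + L • P 0 = y := by simp [hP.2.2]
  have hsplit := integral_add_compl (measurableSet_strip N k L) (hnb 0).1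
  rw [(hnb 0).2] at hsplit
  simp only [hF, hPz] at h0 hsplit
  have hout := outer_potential_le (k := k) hN hL hμ hx y
  linarith

theorem Ub_pos {N : ℕ} (hN : 5 ≤ N) {s : ℝ} (hs : 0 < s) (x : Euc N) {μ : ℝ} (hμ : 0 < μ)
    (y : Euc N) : 0 < Ub N s x μ y := mul_pos hs (Wb_pos hN x hμ y)

theorem Vb_one (N : ℕ) (s : ℝ) : Vb N s 1 = Ub N s := by
  funext x μ y; simp [Vb, Ub]

theorem PV_one (N k : ℕ) (L : ℝ) (P : ℕ → Euc N) (s : ℝ) : PV N k L P s 1 = PU N k L P s 1 := by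
  funext x μ y; simp only [PV, PU, Vb_one]

theorem tS_two_lt {N : ℕ} (hN : 5 ≤ N) : 2 < tS N := by
  have hN' : (5 : ℝ) ≤ N := by exact_mod_cast hN
  unfold tS
  rw [lt_div_iff₀ (by linarith)]; linarith

theorem half_tS_rpow_mul {N : ℕ} (hN : 5 ≤ N) {a : ℝ} (ha : 0 ≤ a) :
    a ^ (tS N / 2 - 1) * a ^ (tS N / 2) = a ^ (tS N - 1) := by
  have := tS_two_lt hN
  rw [← rpow_add_of_nonneg ha (by linarith) (by linarith)]
  congr 1; ring

theorem PU_eq {N k : ℕ} (hN : 5 ≤ N) {s : ℝ} (h : SyncConst N s 1) (L : ℝ) (P : ℕ → Euc N)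
    (x : Euc N) {μ : ℝ} (hμ : 0 < μ) (y : Euc N) :
    PU N k L P s 1 x μ y = s * projW N k L P x μ y := by
  obtain ⟨hs, -, hs1, -⟩ := h
  rw [one_rpow] at hs1
  have hsq : s ^ (tS N - 1) = 2 / 3 * s := by
    rw [show tS N - 1 = (tS N - 2) + 1 by ring, rpow_add hs, rpow_one, hs1]; norm_num
  unfold PU projW
  rw [← integral_const_mul]
  congr 1
  funext z
  have hU := (Ub_pos hN hs x hμ z).le
  rw [Vb_one, mul_assoc, half_tS_rpow_mul hN hU]
  unfold Ub
  rw [mul_rpow hs.le (Wb_pos hN x hμ z).le, hsq]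
  ring

/-- The form of both components of the error term when `κ = 1`. -/
theorem ell1_eq {N k : ℕ} (hN : 5 ≤ N) {s : ℝ} (hs : 0 < s) (L : ℝ) (P : ℕ → Euc N)
    (K : Euc N → ℝ) (x : Euc N) {μ : ℝ} (hμ : 0 < μ) {y : Euc N}
    (hPU : 0 ≤ PU N k L P s 1 x μ y) :
    ell1 N k L P s 1 K x μ y = (K y + 1 / 2) *
      (PU N k L P s 1 x μ y ^ (tS N - 1) - Ub N s x μ y ^ (tS N - 1)) +
      (K y - 1) * Ub N s x μ y ^ (tS N - 1) := by
  unfold ell1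
  rw [PV_one, Vb_one, half_tS_rpow_mul hN hPU, half_tS_rpow_mul hN (Ub_pos hN hs x hμ y).le]
  ring

theorem ell2_one (N k : ℕ) (L : ℝ) (P : ℕ → Euc N) (s : ℝ) :
    ell2 N k L P s 1 = ell1 N k L P s 1 := by
  funext K x μ y
  unfold ell2 ell1
  rw [PV_one, Vb_one]

theorem Admissible.mul_norm_le_one {N : ℕ} {θ C0 β L μ : ℝ} {x : Euc N} (hθ : 0 < θ)
    (h : Admissible N θ C0 β L x μ) : μ * ‖x‖ ≤ 1 := by
  obtain ⟨hμ, -, hx, -⟩ := h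
  have hμ0 : 0 < μ := by linarith
  have h1 : ‖x‖ ≤ μ⁻¹ := hx.trans (by
    rw [← rpow_neg_one]
    exact rpow_le_rpow_of_exponent_le hμ (by linarith))
  calc μ * ‖x‖ ≤ μ * μ⁻¹ := by gcongr
    _ = 1 := mul_inv_cancel₀ hμ0.ne'

/-- The relation between `L` and `μ` encoded in the admissible range. -/
theorem scale_bounds {n β C0 L μ : ℝ} (hn : 0 < n) (hβ : n < β) (hC0 : 0 < C0) (hμ : 1 ≤ μ)
    (hL : 1 ≤ L) (h : μ * L ^ (-(n / (β - n))) ∈ Set.Icc (C0 / 2) (2 * C0)) :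
    (μ * L) ^ (-n) ≤ (2 * C0) ^ (β - n) * μ ^ (-β) ∧
    μ * L ≤ (2 / C0) ^ ((β - n) / n) * μ ^ (β / n) := by
  have hμ0 : 0 < μ := by linarith
  have hL0 : 0 < L := by linarith
  have hb : 0 < β - n := by linarith
  obtain ⟨h1, h2⟩ := h
  have e1 : (L ^ (-(n / (β - n)))) ^ (β - n) = L ^ (-n) := by
    rw [← rpow_mul hL0.le]; congr 1; field_simp
  constructor
  · have h3 := rpow_le_rpow (by positivity) h2 hb.le
    rw [mul_rpow hμ0.le (by positivity), e1] at h3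
    rw [mul_rpow hμ0.le hL0.le]
    calc μ ^ (-n) * L ^ (-n) = μ ^ (-β) * (μ ^ (β - n) * L ^ (-n)) := by
          rw [← mul_assoc, ← rpow_add hμ0]; congr 2; ring
      _ ≤ μ ^ (-β) * (2 * C0) ^ (β - n) := by gcongr
      _ = _ := mul_comm _ _
  · have h3 : L ^ (n / (β - n)) ≤ 2 / C0 * μ := by
      rw [rpow_neg hL0.le, ← div_eq_mul_inv, le_div_iff₀ (by positivity)] at h1
      rw [div_mul_eq_mul_div, le_div_iff₀ hC0]; linarith
    have h4 := rpow_le_rpow (by positivity) h3 (z := (β - n) / n) (by positivity)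
    rw [← rpow_mul hL0.le, div_mul_div_cancel₀ hb.ne', div_self hn.ne', rpow_one,
      mul_rpow (by positivity) hμ0.le] at h4
    calc μ * L ≤ μ * ((2 / C0) ^ ((β - n) / n) * μ ^ ((β - n) / n)) := by gcongr
      _ = (2 / C0) ^ ((β - n) / n) * (μ ^ (1 : ℝ) * μ ^ ((β - n) / n)) := by rw [rpow_one]; ring
      _ = _ := by
        rw [← rpow_add hμ0]; congr 2; field_simp; ring

theorem σw_eq_one {N : ℕ} {x y : Euc N} {μ τ : ℝ} (hμ : 0 < μ) (hτ : 1 ≤ τ)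
    (h : μ ≤ 1 + μ * ‖y - x‖) : σw x μ τ y = 1 :=
  min_eq_left (one_le_rpow ((one_le_div hμ).2 h) (by linarith))

theorem σw_eq_rpow {N : ℕ} {x y : Euc N} {μ τ : ℝ} (hμ : 0 < μ) (hτ : 1 ≤ τ)
    (h : 1 + μ * ‖y - x‖ ≤ μ) :
    σw x μ τ y = (1 + μ * ‖y - x‖) ^ (τ - 1) * μ ^ (-(τ - 1)) := by
  have h1 : 0 ≤ 1 + μ * ‖y - x‖ := by positivity
  unfold σw
  rw [min_eq_right (rpow_le_one (by positivity) ((div_le_one hμ).2 h) (by linarith)),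
    div_rpow h1 hμ.le, rpow_neg hμ.le, div_eq_mul_inv]

theorem σw_pos {N : ℕ} (x y : Euc N) {μ : ℝ} (τ : ℝ) (hμ : 0 < μ) : 0 < σw x μ τ y := by
  unfold σw
  exact lt_min one_pos (by positivity)

theorem weight_interaction_bound {N : ℕ} (hN : 5 ≤ N) {β τ c μ : ℝ} {x y : Euc N}
    (hβ : (N : ℝ) - 2 < β) (hτ1 : 1 < τ) (hτ2 : τ < ((N : ℝ) - 2) / 2) (hc : 0 ≤ c) (hμ : 1 ≤ μ)
    (ht : 1 + μ * ‖y - x‖ ≤ c * μ ^ (β / ((N : ℝ) - 2))) :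
    μ ^ (-β) * (1 + μ * ‖y - x‖) ^ (((N : ℝ) - 6) / 2 + τ) ≤
      (c ^ (((N : ℝ) - 6) / 2 + τ) + 1) * (σw x μ τ y * μ ^ (-2 : ℝ)) := by
  have hN' : (5 : ℝ) ≤ N := by exact_mod_cast hN
  have hμ0 : 0 < μ := by linarith
  have hn : 0 < (N : ℝ) - 2 := by linarith
  have ht0 : 0 < 1 + μ * ‖y - x‖ := by positivity
  have ht1 : 1 ≤ 1 + μ * ‖y - x‖ := le_add_of_nonneg_right (by positivity)
  have hcp : 0 ≤ c ^ (((N : ℝ) - 6) / 2 + τ) := by positivity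
  rcases le_total μ (1 + μ * ‖y - x‖) with h | h
  · rw [σw_eq_one hμ0 hτ1.le h, one_mul]
    set t := 1 + μ * ‖y - x‖
    set p := ((N : ℝ) - 6) / 2 + τ with hp
    have hp0 : 0 < p := by rw [hp]; linarith
    have h1 : t ^ p ≤ c ^ p * μ ^ (β - 2) := by
      refine (rpow_le_rpow ht0.le ht hp0.le).trans ?_
      rw [mul_rpow hc (by positivity), ← rpow_mul hμ0.le]
      refine mul_le_mul_of_nonneg_left (rpow_le_rpow_of_exponent_le hμ ?_) hcp
      rw [div_mul_eq_mul_div, div_le_iff₀ hn]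
      have h2 : p ≤ (N : ℝ) - 2 - 2 := by rw [hp]; linarith
      nlinarith [mul_le_mul_of_nonneg_left h2 (by linarith : 0 ≤ β)]
    calc μ ^ (-β) * t ^ p ≤ μ ^ (-β) * (c ^ p * μ ^ (β - 2)) := by gcongr
      _ = c ^ p * (μ ^ (-β) * μ ^ (β - 2)) := by ring
      _ = c ^ p * μ ^ (-2 : ℝ) := by rw [← rpow_add hμ0]; congr 2; ring
      _ ≤ _ := by gcongr; linarith
  · rw [σw_eq_rpow hμ0 hτ1.le h]
    set t := 1 + μ * ‖y - x‖
    have e1 : t ^ (((N : ℝ) - 6) / 2 + τ) = t ^ (τ - 1) * t ^ (((N : ℝ) - 4) / 2) := by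
      rw [← rpow_add ht0]; congr 1; ring
    rw [e1]
    calc μ ^ (-β) * (t ^ (τ - 1) * t ^ (((N : ℝ) - 4) / 2))
        ≤ μ ^ (-β) * (t ^ (τ - 1) * μ ^ (((N : ℝ) - 4) / 2)) := by
          gcongr
          linarith
      _ = t ^ (τ - 1) * (μ ^ (-β) * μ ^ (((N : ℝ) - 4) / 2)) := by ring
      _ ≤ t ^ (τ - 1) * (μ ^ (-(τ - 1)) * μ ^ (-2 : ℝ)) := by
          rw [← rpow_add hμ0, ← rpow_add hμ0]
          exact mul_le_mul_of_nonneg_left (rpow_le_rpow_of_exponent_le hμ (by linarith))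
            (by positivity)
      _ = 1 * (t ^ (τ - 1) * μ ^ (-(τ - 1)) * μ ^ (-2 : ℝ)) := by ring
      _ ≤ _ := by gcongr; linarith

theorem weight_coefficient_bound {N : ℕ} (hN : 5 ≤ N) {β τ M κ μ : ℝ} {x y : Euc N}
    (hβ : (N : ℝ) - 2 < β) (hτ1 : 1 < τ) (hτ2 : τ < ((N : ℝ) - 2) / 2) (hM : 0 ≤ M) (hμ : 1 ≤ μ)
    (hκ1 : κ ≤ M) (hκ2 : κ ≤ M * (‖y - x‖ ^ β + ‖x‖ ^ β)) :
    κ * (1 + μ * ‖y - x‖) ^ (τ - ((N : ℝ) + 2) / 2) ≤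
      M * (σw x μ τ y * (μ ^ (-2 : ℝ) + (μ * ‖x‖) ^ β * μ ^ (-(β - τ + 1)))) := by
  have hN' : (5 : ℝ) ≤ N := by exact_mod_cast hN
  have hμ0 : 0 < μ := by linarith
  have ht0 : 0 < 1 + μ * ‖y - x‖ := by positivity
  have ht1 : 1 ≤ 1 + μ * ‖y - x‖ := le_add_of_nonneg_right (by positivity)
  rcases le_total μ (1 + μ * ‖y - x‖) with h | h
  · rw [σw_eq_one hμ0 hτ1.le h, one_mul]
    have h1 : (1 + μ * ‖y - x‖) ^ (τ - ((N : ℝ) + 2) / 2) ≤ μ ^ (-2 : ℝ) :=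
      (rpow_le_rpow_of_exponent_le ht1 (by linarith)).trans
        (rpow_le_rpow_of_nonpos hμ0 h (by norm_num))
    refine mul_le_mul hκ1 (h1.trans (le_add_of_nonneg_right (by positivity)))
      (by positivity) hM
  · rw [σw_eq_rpow hμ0 hτ1.le h]
    have hd : ‖y - x‖ ≤ (1 + μ * ‖y - x‖) / μ := by
      rw [le_div_iff₀ hμ0]; linarith
    have hdβ := rpow_le_rpow (norm_nonneg _) hd (z := β) (by linarith)
    rw [div_rpow ht0.le hμ0.le] at hdβ
    set t := 1 + μ * ‖y - x‖
    have hx0 := norm_nonneg x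
    have e1 : t ^ (τ - ((N : ℝ) + 2) / 2) = t ^ (τ - 1) * t ^ (-((N : ℝ) / 2)) := by
      rw [← rpow_add ht0]; congr 1; ring
    have h2 : t ^ β / μ ^ β * t ^ (-((N : ℝ) / 2)) ≤ μ ^ (-(τ - 1)) * μ ^ (-2 : ℝ) := by
      calc t ^ β / μ ^ β * t ^ (-((N : ℝ) / 2))
          = μ ^ (-β) * t ^ (β - (N : ℝ) / 2) := by
            rw [rpow_neg hμ0.le, sub_eq_add_neg, rpow_add ht0]; field_simp
        _ ≤ μ ^ (-β) * μ ^ (β - (N : ℝ) / 2) := by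
            gcongr
            linarith
        _ ≤ _ := by
            rw [← rpow_add hμ0, ← rpow_add hμ0]
            exact rpow_le_rpow_of_exponent_le hμ (by linarith)
    have h3 : ‖x‖ ^ β * t ^ (-((N : ℝ) / 2)) ≤
        μ ^ (-(τ - 1)) * ((μ * ‖x‖) ^ β * μ ^ (-(β - τ + 1))) := by
      have h4 : t ^ (-((N : ℝ) / 2)) ≤ 1 := rpow_le_one_of_one_le_of_nonpos ht1 (by linarith)
      have e2 : μ ^ (-(τ - 1)) * ((μ * ‖x‖) ^ β * μ ^ (-(β - τ + 1))) = ‖x‖ ^ β := by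
        rw [mul_rpow hμ0.le hx0]
        have : μ ^ (-(τ - 1)) * μ ^ β * μ ^ (-(β - τ + 1)) = 1 := by
          rw [← rpow_add hμ0, ← rpow_add hμ0, ← rpow_zero μ]; congr 1; ring
        linear_combination ‖x‖ ^ β * this
      rw [e2]
      exact mul_le_of_le_one_right (by positivity) h4
    rw [e1]
    calc κ * (t ^ (τ - 1) * t ^ (-((N : ℝ) / 2)))
        ≤ M * (t ^ β / μ ^ β + ‖x‖ ^ β) * (t ^ (τ - 1) * t ^ (-((N : ℝ) / 2))) := by
          gcongr
          exact hκ2.trans (by gcongr)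
      _ = M * (t ^ (τ - 1) * (t ^ β / μ ^ β * t ^ (-((N : ℝ) / 2)) +
          ‖x‖ ^ β * t ^ (-((N : ℝ) / 2)))) := by ring
      _ ≤ M * (t ^ (τ - 1) * (μ ^ (-(τ - 1)) * μ ^ (-2 : ℝ) +
          μ ^ (-(τ - 1)) * ((μ * ‖x‖) ^ β * μ ^ (-(β - τ + 1))))) := by gcongr
      _ = _ := by ring

/-- Hölder's inequality for sums of negative powers. -/
theorem tsum_rpow_neg_rpow_le {D : ℕ → ℝ} (hD : ∀ j, 0 < D j) {q A E n : ℝ} (hq : 1 < q)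
    (hn : n * q = A + E * (q - 1)) (hA : Summable fun j => D j ^ (-A))
    (hE : Summable fun j => D j ^ (-E)) :
    (∑' j, D j ^ (-n)) ^ q ≤ (∑' j, D j ^ (-A)) * (∑' j, D j ^ (-E)) ^ (q - 1) := by
  have hq0 : 0 < q := by linarith
  have hq1 : 0 < q - 1 := by linarith
  have hpq : q.HolderConjugate (q / (q - 1)) := Real.HolderConjugate.conjExponent hq
  have ef : ∀ j, (D j ^ (-(A / q))) ^ q = D j ^ (-A) := fun j => by
    rw [← rpow_mul (hD j).le]; congr 1; field_simp
  have eg : ∀ j, (D j ^ (-(E * (q - 1) / q))) ^ (q / (q - 1)) = D j ^ (-E) := fun j => by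
    rw [← rpow_mul (hD j).le]; congr 1; field_simp
  have efg : ∀ j, D j ^ (-(A / q)) * D j ^ (-(E * (q - 1) / q)) = D j ^ (-n) := fun j => by
    rw [← rpow_add (hD j)]; congr 1; field_simp; linarith
  have h := Real.inner_le_Lp_mul_Lq_tsum_of_nonneg hpq
    (f := fun j => D j ^ (-(A / q))) (g := fun j => D j ^ (-(E * (q - 1) / q)))
    (fun j => rpow_nonneg (hD j).le _) (fun j => rpow_nonneg (hD j).le _)
    (by simpa only [ef] using hA) (by simpa only [eg] using hE)
  simp only [ef, eg, efg] at h
  have hA0 : 0 ≤ ∑' j, D j ^ (-A) := tsum_nonneg fun j => rpow_nonneg (hD j).le _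
  have hE0 : 0 ≤ ∑' j, D j ^ (-E) := tsum_nonneg fun j => rpow_nonneg (hD j).le _
  have h2 := rpow_le_rpow (tsum_nonneg fun j => rpow_nonneg (hD j).le _) h hq0.le
  rw [mul_rpow (by positivity) (by positivity), ← rpow_mul hA0, ← rpow_mul hE0,
    one_div_mul_cancel hq0.ne', rpow_one] at h2
  convert h2 using 3
  field_simp

theorem CondA.coefficient_bound {N k : ℕ} {K : Euc N → ℝ} {a b : Fin N → ℝ}
    {βm βM σ : ℝ} (h : CondA N k K a b βm βM σ) {β : ℝ} (hβ0 : 0 ≤ β) (hβ : β ≤ βm) :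
    ∃ M : ℝ, 0 ≤ M ∧ (∀ y, |K y| ≤ M) ∧ (∀ y, |K y - 1| ≤ M) ∧
      ∀ x y, |K y - 1| ≤ M * (‖y - x‖ ^ β + ‖x‖ ^ β) := by
  obtain ⟨M, hM⟩ := h.bounded
  obtain ⟨δ, C, hδ, hC, hexp⟩ := h.expansion
  have hM0 : 0 ≤ M := (abs_nonneg _).trans (hM 0)
  have hM1 : ∀ y, |K y - 1| ≤ M + 1 := fun y => by
    have := abs_sub (K y) 1
    rw [abs_one] at this
    linarith [hM y]
  set A := ∑ i, |a i| with hA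
  have hA0 : 0 ≤ A := Finset.sum_nonneg fun i _ => abs_nonneg _
  set d := min δ 1 with hd
  have hd0 : 0 < d := lt_min hδ one_pos
  have hβM : βm ≤ βM := by
    obtain ⟨i, hi⟩ := h.βm_mem
    exact hi ▸ h.le_βM i
  set B := (A + C) + (M + 1) * d ^ (-β) with hB
  have hB0 : 0 ≤ B := by positivity
  have hloc : ∀ y, |K y - 1| ≤ B * ‖y‖ ^ β := by
    intro y
    rcases lt_or_ge ‖y‖ d with hy | hy
    · have hy1 : ‖y‖ ≤ 1 := hy.le.trans (min_le_right _ _)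
      have h1 := hexp y (hy.trans_le (min_le_left _ _))
      have hpow : ∀ r, β ≤ r → ‖y‖ ^ r ≤ ‖y‖ ^ β := fun r hr =>
        rpow_le_rpow_of_exponent_ge' (norm_nonneg _) hy1 hβ0 hr
      have h2 : |∑ i, a i * |y i| ^ b i| ≤ A * ‖y‖ ^ β := by
        refine (Finset.abs_sum_le_sum_abs _ _).trans ?_
        rw [hA, Finset.sum_mul]
        refine Finset.sum_le_sum fun i _ => ?_
        have hyi : |y i| ≤ ‖y‖ := by simpa using PiLp.norm_apply_le y i
        rw [abs_mul, abs_of_nonneg (rpow_nonneg (abs_nonneg (y i)) _)]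
        refine mul_le_mul_of_nonneg_left ?_ (abs_nonneg _)
        have hbi := hβ.trans (h.βm_le i)
        exact (rpow_le_rpow (abs_nonneg _) hyi (hβ0.trans hbi)).trans (hpow _ hbi)
      have h3 : C * ‖y‖ ^ (βM + σ) ≤ C * ‖y‖ ^ β :=
        mul_le_mul_of_nonneg_left (hpow _ (by linarith [h.σ_pos])) hC.le
      have h4 : |K y - 1| ≤ (A + C) * ‖y‖ ^ β := by
        have := abs_add_le (K y - 1 - ∑ i, a i * |y i| ^ b i) (∑ i, a i * |y i| ^ b i)
        rw [sub_add_cancel] at this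
        linarith
      refine h4.trans (mul_le_mul_of_nonneg_right ?_ (by positivity))
      rw [hB]
      exact le_add_of_nonneg_right (by positivity)
    · have h1 : 1 ≤ d ^ (-β) * ‖y‖ ^ β := by
        rw [rpow_neg hd0.le, ← div_eq_inv_mul, one_le_div (by positivity)]
        exact rpow_le_rpow hd0.le hy hβ0
      calc |K y - 1| ≤ (M + 1) * 1 := by linarith [hM1 y]
        _ ≤ (M + 1) * (d ^ (-β) * ‖y‖ ^ β) := by gcongr
        _ = (M + 1) * d ^ (-β) * ‖y‖ ^ β := by ring
        _ ≤ _ := by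
            refine mul_le_mul_of_nonneg_right ?_ (by positivity)
            rw [hB]; linarith
  refine ⟨M + 1 + B * 2 ^ β, by positivity, fun y => ?_, fun y => ?_, fun x y => ?_⟩
  · have : 0 ≤ B * 2 ^ β := by positivity
    linarith [hM y]
  · have : 0 ≤ B * 2 ^ β := by positivity
    linarith [hM1 y]
  · have h1 : ‖y‖ ≤ 2 * max ‖y - x‖ ‖x‖ := by
      have : ‖y‖ ≤ ‖y - x‖ + ‖x‖ := by simpa using norm_add_le (y - x) x
      linarith [le_max_left ‖y - x‖ ‖x‖, le_max_right ‖y - x‖ ‖x‖]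
    have h2 : (max ‖y - x‖ ‖x‖) ^ β ≤ ‖y - x‖ ^ β + ‖x‖ ^ β := by
      rcases max_choice ‖y - x‖ ‖x‖ with e | e <;> rw [e]
      · exact le_add_of_nonneg_right (by positivity)
      · exact le_add_of_nonneg_left (by positivity)
    calc |K y - 1| ≤ B * ‖y‖ ^ β := hloc y
      _ ≤ B * (2 * max ‖y - x‖ ‖x‖) ^ β := by gcongr
      _ = B * 2 ^ β * (max ‖y - x‖ ‖x‖) ^ β := by
          rw [mul_rpow (by norm_num) (by positivity)]; ring
      _ ≤ (M + 1 + B * 2 ^ β) * (‖y - x‖ ^ β + ‖x‖ ^ β) := by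
          refine mul_le_mul (by linarith) h2 (by positivity) (by positivity)

theorem abs_rpow_sub_rpow_le {a b q c : ℝ} (ha : 0 ≤ a) (hb : 0 < b) (hc : 1 ≤ c)
    (hab : a ≤ c * b) (hq : 1 < q) :
    |a ^ q - b ^ q| ≤ q * (c * b) ^ (q - 1) * |a - b| := by
  have hder : ∀ z ∈ Set.Icc 0 (c * b), HasDerivWithinAt (fun z : ℝ => z ^ q) (q * z ^ (q - 1))
      (Set.Icc 0 (c * b)) z := fun z _ =>
    (hasDerivAt_rpow_const (Or.inr hq.le)).hasDerivWithinAt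
  have hbd : ∀ z ∈ Set.Icc 0 (c * b), ‖q * z ^ (q - 1)‖ ≤ q * (c * b) ^ (q - 1) := by
    intro z hz
    rw [Real.norm_of_nonneg (mul_nonneg (by linarith) (rpow_nonneg hz.1 _))]
    exact mul_le_mul_of_nonneg_left (rpow_le_rpow hz.1 hz.2 (by linarith)) (by linarith)
  simpa only [Real.norm_eq_abs] using
    (convex_Icc 0 (c * b)).norm_image_sub_le_of_norm_hasDerivWithin_le hder hbd
    (⟨hb.le, by nlinarith⟩ : b ∈ Set.Icc 0 (c * b)) (⟨ha, hab⟩ : a ∈ Set.Icc 0 (c * b))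

theorem wStarStar_eq (N : ℕ) (L : ℝ) (P : ℕ → Euc N) (x : Euc N) {μ : ℝ} (hμ : 0 < μ) (τ : ℝ)
    (y : Euc N) : wStarStar N L P x μ τ y = σw x μ τ y * (μ ^ (((N : ℝ) + 2) / 2) *
      ∑' j, (1 + μ * ‖y - xc L P x j‖) ^ (-(((N : ℝ) + 2) / 2 + τ))) := by
  rw [wStarStar, ← tsum_mul_left (a := μ ^ (((N : ℝ) + 2) / 2))]
  congr 2
  funext j
  rw [rpow_neg (by positivity), div_eq_mul_inv]

theorem first_le_wStarStar {N k : ℕ} (hkN : k ≤ N) {P : ℕ → Euc N} (hP : LatticeEnum N k P)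
    {L μ : ℝ} (hL : 0 < L) (hμ : 0 < μ) {x y : Euc N} (hx : μ * ‖x‖ ≤ 1)
    (hy : y ∈ strip N k L) {τ : ℝ} (hτ : (k : ℝ) < τ) :
    σw x μ τ y * (μ ^ (((N : ℝ) + 2) / 2) *
      (1 + μ * ‖y - x‖) ^ (-(((N : ℝ) + 2) / 2 + τ))) ≤ wStarStar N L P x μ τ y := by
  have hN0 : (0 : ℝ) ≤ N := by positivity
  rw [wStarStar_eq N L P x hμ]
  have hsum := (hP.tail_sum hkN hL hμ hx hy
    (p := ((N : ℝ) + 2) / 2 + τ) (by linarith)).1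
  have h := hsum.le_tsum 0 fun j _ => by positivity
  rw [hP.xc_zero] at h
  have := σw_pos x y τ hμ
  gcongr

theorem Wb_rpow_le {N : ℕ} (hN : 5 ≤ N) (x : Euc N) {μ : ℝ} (hμ : 0 < μ) (y : Euc N) {r : ℝ}
    (hr : 0 ≤ r) : Wb N x μ y ^ r ≤ (bubbleConst N * 2 ^ (((N : ℝ) - 2) / 2)) ^ r *
      (μ ^ (((N : ℝ) - 2) / 2 * r) * (1 + μ * ‖y - x‖) ^ (-(((N : ℝ) - 2) * r))) := by
  have hb := bubbleConst_pos hN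
  refine (rpow_le_rpow (Wb_pos hN x hμ y).le (Wb_le hN x hμ y) hr).trans_eq ?_
  rw [mul_rpow (by positivity) (by positivity), mul_rpow (by positivity) (by positivity),
    ← rpow_mul hμ.le, ← rpow_mul (by positivity), mul_assoc]
  congr 3; ring

/-- Comparison of the projected bubble with the bubble in the part `|y| ≤ L` of the strip. -/
theorem exists_inner_interaction_bound {N k : ℕ} (hN : 5 ≤ N) (hk1 : 1 ≤ k)
    {P : ℕ → Euc N} (hP : LatticeEnum N k P)
    {τ θ C0 β : ℝ} (hτk : (k : ℝ) < τ) (hτN : τ < ((N : ℝ) - 2) / 2) (hθ : 0 < θ) (hC0 : 0 < C0)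
    (hβ : (N : ℝ) - 2 < β) :
    ∃ C : ℝ, 0 ≤ C ∧ ∀ (L : ℝ) (x : Euc N) (μ : ℝ), Admissible N θ C0 β L x μ →
      ∀ y ∈ strip N k L, ‖y‖ ≤ L →
        |projW N k L P x μ y ^ (tS N - 1) - Wb N x μ y ^ (tS N - 1)| ≤
          C * (μ ^ (-2 : ℝ) * (σw x μ τ y * (μ ^ (((N : ℝ) + 2) / 2) *
            (1 + μ * ‖y - x‖) ^ (-(((N : ℝ) + 2) / 2 + τ))))) := by
  have hN' : (5 : ℝ) ≤ N := by exact_mod_cast hN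
  have hk1' : (1 : ℝ) ≤ k := by exact_mod_cast hk1
  have hn : 0 < (N : ℝ) - 2 := by linarith
  have hkn : (k : ℝ) < (N : ℝ) - 2 := by linarith
  have hb := bubbleConst_pos hN
  have hq2 := tS_two_lt hN
  set c1 := bubbleConst N * 2 ^ (((N : ℝ) - 2) / 2) with hc1
  set cS := c1 * ((∑' j, ‖P j‖ ^ (-((N : ℝ) - 2))) * 2 ^ ((N : ℝ) - 2)) with hcS
  set cT := 9 ^ (((N : ℝ) + 2) / 2) * bubbleConst N with hcT
  have hs0 : 0 ≤ ∑' j, ‖P j‖ ^ (-((N : ℝ) - 2)) := tsum_nonneg fun j => by positivity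
  have hcS0 : 0 ≤ cS := by positivity
  have hcT0 : 0 ≤ cT := by positivity
  set c3 := 1 + cS * 3 ^ ((N : ℝ) - 2) / bubbleConst N with hc3
  have hc31 : 1 ≤ c3 := le_add_of_nonneg_right (by positivity)
  set c4 := (2 * C0) ^ (β - ((N : ℝ) - 2)) with hc4
  set c6 := 3 * (2 / C0) ^ ((β - ((N : ℝ) - 2)) / ((N : ℝ) - 2)) with hc6
  set c5 := c6 ^ (((N : ℝ) - 6) / 2 + τ) + 1 with hc5
  refine ⟨(tS N - 1) * (c3 ^ (tS N - 2) * c1 ^ (tS N - 2)) * ((cS + cT) * c4) * c5,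
    by have : 0 ≤ tS N - 1 := by linarith
       positivity, ?_⟩
  intro L x μ hadm y hy hyL
  have hx := hadm.mul_norm_le_one hθ
  obtain ⟨hμ, hL, -, hsc⟩ := hadm
  have hμ0 : 0 < μ := by linarith
  have hL0 : 0 < L := by linarith
  obtain ⟨hs1, hs2⟩ := scale_bounds hn hβ hC0 hμ hL hsc
  have hW := Wb_pos hN x hμ0 y
  obtain ⟨hp0, hp1, hp2⟩ := projW_bounds hN hkn hP hL hμ hx hy
  have htail := tail_Wb_le hN hkn hP hL0 hμ0 hx hy
  rw [(summable_Wb hN hkn hP hL0 hμ0 hx hy).tsum_eq_zero_add,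
    show y + L • P 0 = y by simp [hP.2.2]] at hp1
  have hlow := le_Wb hN x hμ0 y
  have hup := Wb_rpow_le hN x hμ0 y (r := tS N - 2) (by linarith)
  have ht3 : 1 + μ * ‖y - x‖ ≤ 3 * (μ * L) := by
    have h1 : ‖y - x‖ ≤ L + ‖x‖ := (norm_sub_le y x).trans (by linarith)
    nlinarith [mul_le_mul_of_nonneg_left h1 hμ0.le, mul_le_mul hμ hL zero_le_one hμ0.le]
  have ht0 : 0 < 1 + μ * ‖y - x‖ := by positivity
  have hkey := weight_interaction_bound hN (x := x) (y := y) hβ (hk1'.trans_lt hτk) hτN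
    (c := c6) (by positivity) hμ (by rw [hc6, mul_assoc]; linarith)
  set t := 1 + μ * ‖y - x‖
  set W := Wb N x μ y
  set PW := projW N k L P x μ y
  set η := μ ^ (((N : ℝ) - 2) / 2) * (μ * L) ^ (-((N : ℝ) - 2)) with hη
  have hη0 : 0 ≤ η := by positivity
  have hηW : η ≤ 3 ^ ((N : ℝ) - 2) / bubbleConst N * W := by
    have h1 : (3 * (μ * L)) ^ (-((N : ℝ) - 2)) ≤ t ^ (-((N : ℝ) - 2)) :=
      rpow_le_rpow_of_nonpos ht0 ht3 (by linarith)
    rw [mul_rpow (by norm_num) (by positivity), rpow_neg (by norm_num : (0 : ℝ) ≤ 3)] at h1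
    have h2 : (μ * L) ^ (-((N : ℝ) - 2)) ≤ 3 ^ ((N : ℝ) - 2) * t ^ (-((N : ℝ) - 2)) := by
      rwa [inv_mul_le_iff₀ (by positivity)] at h1
    rw [div_mul_eq_mul_div, le_div_iff₀ hb]
    calc η * bubbleConst N ≤ μ ^ (((N : ℝ) - 2) / 2) *
          (3 ^ ((N : ℝ) - 2) * t ^ (-((N : ℝ) - 2))) * bubbleConst N := by rw [hη]; gcongr
      _ = 3 ^ ((N : ℝ) - 2) *
          (bubbleConst N * μ ^ (((N : ℝ) - 2) / 2) * t ^ (-((N : ℝ) - 2))) := by ring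
      _ ≤ _ := by gcongr
  have hPW : PW ≤ c3 * W := by
    have h1 : cS * η ≤ cS * (3 ^ ((N : ℝ) - 2) / bubbleConst N * W) := by gcongr
    have h2 : c3 * W = W + cS * (3 ^ ((N : ℝ) - 2) / bubbleConst N * W) := by rw [hc3]; ring
    linarith
  have hdiff : |PW - W| ≤ (cS + cT) * η := by
    have h1 : 0 ≤ cS * η := by positivity
    have h2 : 0 ≤ cT * η := by positivity
    rw [abs_le]; constructor <;> linarith
  have hη2 : η ≤ μ ^ (((N : ℝ) - 2) / 2) * (c4 * μ ^ (-β)) := by rw [hη]; gcongr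
  have hmv := abs_rpow_sub_rpow_le hp0 hW hc31 hPW (by linarith : 1 < tS N - 1)
  have e2 : tS N - 1 - 1 = tS N - 2 := by ring
  rw [e2, mul_rpow (by positivity) hW.le] at hmv
  have e3 : ((N : ℝ) - 2) * (tS N - 2) = 4 := by unfold tS; field_simp; ring
  have e4 : ((N : ℝ) - 2) / 2 * (tS N - 2) = 2 := by linarith
  rw [e3, e4] at hup
  have hq0 : 0 ≤ tS N - 1 := by linarith
  calc |PW ^ (tS N - 1) - W ^ (tS N - 1)|
      ≤ (tS N - 1) * (c3 ^ (tS N - 2) * W ^ (tS N - 2)) * |PW - W| := hmv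
    _ ≤ (tS N - 1) * (c3 ^ (tS N - 2) * (c1 ^ (tS N - 2) * (μ ^ (2 : ℝ) * t ^ (-4 : ℝ)))) *
        ((cS + cT) * (μ ^ (((N : ℝ) - 2) / 2) * (c4 * μ ^ (-β)))) := by
        gcongr
        exact hdiff.trans (by gcongr)
    _ = (tS N - 1) * (c3 ^ (tS N - 2) * c1 ^ (tS N - 2)) * ((cS + cT) * c4) *
        (μ ^ (-β) * t ^ (((N : ℝ) - 6) / 2 + τ) * (μ ^ (((N : ℝ) + 2) / 2) *
            t ^ (-(((N : ℝ) + 2) / 2 + τ)))) := by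
        have e5 : μ ^ (((N : ℝ) + 2) / 2) = μ ^ (2 : ℝ) * μ ^ (((N : ℝ) - 2) / 2) := by
          rw [← rpow_add hμ0]; congr 1; ring
        have e6 : t ^ (-4 : ℝ) = t ^ (((N : ℝ) - 6) / 2 + τ) *
            t ^ (-(((N : ℝ) + 2) / 2 + τ)) := by
          rw [← rpow_add ht0]; congr 1; ring
        rw [e5, e6]; ring
    _ ≤ (tS N - 1) * (c3 ^ (tS N - 2) * c1 ^ (tS N - 2)) * ((cS + cT) * c4) *
        (c5 * (σw x μ τ y * μ ^ (-2 : ℝ)) * (μ ^ (((N : ℝ) + 2) / 2) *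
            t ^ (-(((N : ℝ) + 2) / 2 + τ)))) := by gcongr
    _ = _ := by ring

/-- Pointwise bound of the error term in the part `|y| ≤ L` of the strip. -/
theorem exists_inner_bound {N k : ℕ} (hN : 5 ≤ N) (hk1 : 1 ≤ k)
    {P : ℕ → Euc N} (hP : LatticeEnum N k P)
    {τ θ C0 β s M : ℝ} (hτk : (k : ℝ) < τ) (hτN : τ < ((N : ℝ) - 2) / 2) (hθ : 0 < θ)
    (hC0 : 0 < C0) (hβ : (N : ℝ) - 2 < β) (hs : SyncConst N s 1) (hM : 0 ≤ M) {K : Euc N → ℝ}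
    (hK0 : ∀ y, |K y| ≤ M) (hK1 : ∀ y, |K y - 1| ≤ M)
    (hK2 : ∀ x y, |K y - 1| ≤ M * (‖y - x‖ ^ β + ‖x‖ ^ β)) :
    ∃ C : ℝ, 0 ≤ C ∧ ∀ (L : ℝ) (x : Euc N) (μ : ℝ), Admissible N θ C0 β L x μ →
      ∀ y ∈ strip N k L, ‖y‖ ≤ L → |ell1 N k L P s 1 K x μ y| ≤
        C * (μ ^ (-2 : ℝ) + (μ * ‖x‖) ^ β * μ ^ (-(β - τ + 1))) * wStarStar N L P x μ τ y := by
  have hN' : (5 : ℝ) ≤ N := by exact_mod_cast hN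
  have hk1' : (1 : ℝ) ≤ k := by exact_mod_cast hk1
  have hn : 0 < (N : ℝ) - 2 := by linarith
  have hkn : (k : ℝ) < (N : ℝ) - 2 := by linarith
  have hkN : k ≤ N := by
    have : (k : ℝ) ≤ N := by linarith
    exact_mod_cast this
  have hb := bubbleConst_pos hN
  have hq2 := tS_two_lt hN
  have hs0 := hs.1
  obtain ⟨C, hC, hint⟩ := exists_inner_interaction_bound hN hk1 hP hτk hτN hθ hC0 hβ
  set c1 := bubbleConst N * 2 ^ (((N : ℝ) - 2) / 2) with hc1
  refine ⟨s ^ (tS N - 1) * ((M + 1 / 2) * C + c1 ^ (tS N - 1) * M), by positivity, ?_⟩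
  intro L x μ hadm y hy hyL
  have hx := hadm.mul_norm_le_one hθ
  have h1 := hint L x μ hadm y hy hyL
  obtain ⟨hμ, hL, -, -⟩ := hadm
  have hμ0 : 0 < μ := by linarith
  have hL0 : 0 < L := by linarith
  have hW := Wb_pos hN x hμ0 y
  have hp0 := (projW_bounds hN hkn hP hL hμ hx hy).1
  have hw := first_le_wStarStar hkN hP hL0 hμ0 hx hy hτk
  have hup := Wb_rpow_le hN x hμ0 y (r := tS N - 1) (by linarith)
  have e3 : ((N : ℝ) - 2) * (tS N - 1) = N + 2 := by unfold tS; field_simp; ring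
  have e4 : ((N : ℝ) - 2) / 2 * (tS N - 1) = (N + 2) / 2 := by linarith
  rw [e3, e4] at hup
  have hcoef := weight_coefficient_bound hN (x := x) (y := y) hβ (hk1'.trans_lt hτk) hτN hM hμ
    (hK1 y) (hK2 x y)
  have hσ := σw_pos x y τ hμ0
  have hx0 := norm_nonneg x
  have ht0 : 0 < 1 + μ * ‖y - x‖ := by positivity
  rw [ell1_eq hN hs0 L P K x hμ0 (by rw [PU_eq hN hs L P x hμ0]; positivity),
    PU_eq hN hs L P x hμ0, Ub, mul_rpow hs0.le hp0, mul_rpow hs0.le hW.le, ← mul_sub]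
  set t := 1 + μ * ‖y - x‖
  set W := Wb N x μ y
  set PW := projW N k L P x μ y
  set Q := (μ * ‖x‖) ^ β * μ ^ (-(β - τ + 1)) with hQ
  have hQ0 : 0 ≤ Q := by positivity
  set w0 := σw x μ τ y * (μ ^ (((N : ℝ) + 2) / 2) * t ^ (-(((N : ℝ) + 2) / 2 + τ))) with hw0
  have hw00 : 0 ≤ w0 := by positivity
  have hK3 : |K y + 1 / 2| ≤ M + 1 / 2 := (abs_add_le _ _).trans (by
    rw [abs_of_pos (by norm_num : (0 : ℝ) < 1 / 2)]; linarith [hK0 y])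
  have h2 : |K y - 1| * W ^ (tS N - 1) ≤ c1 ^ (tS N - 1) * M * ((μ ^ (-2 : ℝ) + Q) * w0) := by
    calc |K y - 1| * W ^ (tS N - 1) ≤ |K y - 1| *
          (c1 ^ (tS N - 1) * (μ ^ (((N : ℝ) + 2) / 2) * t ^ (-((N : ℝ) + 2)))) := by gcongr
      _ = c1 ^ (tS N - 1) * (|K y - 1| * t ^ (τ - ((N : ℝ) + 2) / 2) *
          (μ ^ (((N : ℝ) + 2) / 2) * t ^ (-(((N : ℝ) + 2) / 2 + τ)))) := by
          have e6 : t ^ (-((N : ℝ) + 2)) = t ^ (τ - ((N : ℝ) + 2) / 2) *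
              t ^ (-(((N : ℝ) + 2) / 2 + τ)) := by
            rw [← rpow_add ht0]; congr 1; ring
          rw [e6]; ring
      _ ≤ c1 ^ (tS N - 1) * (M * (σw x μ τ y * (μ ^ (-2 : ℝ) + Q)) *
          (μ ^ (((N : ℝ) + 2) / 2) * t ^ (-(((N : ℝ) + 2) / 2 + τ)))) := by gcongr
      _ = _ := by rw [hw0]; ring
  have h3 : |PW ^ (tS N - 1) - W ^ (tS N - 1)| ≤ C * ((μ ^ (-2 : ℝ) + Q) * w0) :=
    h1.trans (by gcongr; linarith)
  calc _ ≤ |K y + 1 / 2| * (s ^ (tS N - 1) * |PW ^ (tS N - 1) - W ^ (tS N - 1)|) +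
        |K y - 1| * (s ^ (tS N - 1) * W ^ (tS N - 1)) := by
        refine (abs_add_le _ _).trans_eq ?_
        simp only [abs_mul, abs_of_pos (rpow_pos_of_pos hs0 (tS N - 1)),
          abs_of_pos (rpow_pos_of_pos hW (tS N - 1))]
    _ = |K y + 1 / 2| * (s ^ (tS N - 1) * |PW ^ (tS N - 1) - W ^ (tS N - 1)|) +
        s ^ (tS N - 1) * (|K y - 1| * W ^ (tS N - 1)) := by ring
    _ ≤ (M + 1 / 2) * (s ^ (tS N - 1) * (C * ((μ ^ (-2 : ℝ) + Q) * w0))) +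
        s ^ (tS N - 1) * (c1 ^ (tS N - 1) * M * ((μ ^ (-2 : ℝ) + Q) * w0)) := by gcongr
    _ = s ^ (tS N - 1) * ((M + 1 / 2) * C + c1 ^ (tS N - 1) * M) * (μ ^ (-2 : ℝ) + Q) * w0 := by
        ring
    _ ≤ _ := by gcongr

/-- Pointwise bound of the error term in the part `|y| > L` of the strip. -/
theorem exists_outer_bound {N k : ℕ} (hN : 5 ≤ N) (hk1 : 1 ≤ k)
    {P : ℕ → Euc N} (hP : LatticeEnum N k P)
    {τ θ C0 β s M : ℝ} (hτk : (k : ℝ) < τ) (hτN : τ < ((N : ℝ) - 2) / 2) (hθ : 0 < θ)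
    (hs : SyncConst N s 1) (hM : 0 ≤ M) {K : Euc N → ℝ}
    (hK0 : ∀ y, |K y| ≤ M) (hK1 : ∀ y, |K y - 1| ≤ M) :
    ∃ C : ℝ, 0 ≤ C ∧ ∀ (L : ℝ) (x : Euc N) (μ : ℝ), Admissible N θ C0 β L x μ →
      ∀ y ∈ strip N k L, L < ‖y‖ → |ell1 N k L P s 1 K x μ y| ≤
        C * μ ^ (-2 : ℝ) * wStarStar N L P x μ τ y := by
  have hN' : (5 : ℝ) ≤ N := by exact_mod_cast hN
  have hk1' : (1 : ℝ) ≤ k := by exact_mod_cast hk1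
  have hn : 0 < (N : ℝ) - 2 := by linarith
  have hkn : (k : ℝ) < (N : ℝ) - 2 := by linarith
  have hkN : k ≤ N := by
    have : (k : ℝ) ≤ N := by linarith
    exact_mod_cast this
  have hb := bubbleConst_pos hN
  have hq2 := tS_two_lt hN
  have hs0 := hs.1
  set c1 := bubbleConst N * 2 ^ (((N : ℝ) - 2) / 2) with hc1
  set A := ((N : ℝ) + 2) / 2 + τ with hA
  set E := ((N : ℝ) - 2) / 4 * (((N : ℝ) + 2) / 2 - τ) with hE
  have hEk : (k : ℝ) < E := by rw [hE]; nlinarith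
  have hE0 : 0 < E := by linarith
  set cE := 1 + (∑' j, ‖P j‖ ^ (-E)) * 2 ^ E with hcE
  have hs1 : 0 ≤ ∑' j, ‖P j‖ ^ (-E) := tsum_nonneg fun j => by positivity
  have hcE0 : 0 ≤ cE := by positivity
  refine ⟨(2 * M + 1 / 2) * (s * c1) ^ (tS N - 1) * cE ^ (tS N - 2), by positivity, ?_⟩
  intro L x μ hadm y hy hyL
  have hx := hadm.mul_norm_le_one hθ
  obtain ⟨hμ, hL, -, -⟩ := hadm
  have hμ0 : 0 < μ := by linarith
  have hL0 : 0 < L := by linarith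
  have hW := Wb_pos hN x hμ0 y
  obtain ⟨hp0, hp1, -⟩ := projW_bounds hN hkn hP hL hμ hx hy
  have hsW := summable_Wb hN hkn hP hL0 hμ0 hx hy
  have hWS : Wb N x μ y ≤ ∑' j, Wb N x μ (y + L • P j) := by
    have := hsW.le_tsum 0 fun j _ => (Wb_pos hN x hμ0 _).le
    rwa [show y + L • P 0 = y by simp [hP.2.2]] at this
  have hSD := tsum_Wb_le hN hkn hP hL0 hμ0 hx hy
  have hD0 : μ * L ≤ 1 + μ * ‖y - x‖ :=
    le_trans (by gcongr) (one_add_mul_norm_sub_ge hμ0.le hx y)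
  have hμL : μ ≤ μ * L := le_mul_of_one_le_right hμ0.le hL
  have hσ : σw x μ τ y = 1 :=
    σw_eq_one hμ0 (hk1'.trans hτk.le) (hμL.trans hD0)
  obtain ⟨hE1, hE2⟩ := hP.tail_sum hkN hL0 hμ0 hx hy hEk
  have hA1 := (hP.tail_sum hkN hL0 hμ0 hx hy (p := A) (by rw [hA]; linarith)).1
  have eq1 : tS N - 1 - 1 = tS N - 2 := by ring
  have e4 : tS N - 2 = 4 / ((N : ℝ) - 2) := by unfold tS; field_simp; ring
  have hHol := tsum_rpow_neg_rpow_le (n := (N : ℝ) - 2)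
    (D := fun j => 1 + μ * ‖y - xc L P x j‖) (fun j => by positivity)
    (by linarith : 1 < tS N - 1) (by
      rw [eq1, show tS N - 1 = (tS N - 2) + 1 by ring, e4, hA, hE]; field_simp; ring) hA1 hE1
  rw [eq1] at hHol
  have hEsum : ∑' j, (1 + μ * ‖y - xc L P x j‖) ^ (-E) ≤ cE * (μ * L) ^ (-E) := by
    rw [hE1.tsum_eq_zero_add, hP.xc_zero]
    have h1 : (1 + μ * ‖y - x‖) ^ (-E) ≤ (μ * L) ^ (-E) :=
      rpow_le_rpow_of_nonpos (by positivity) hD0 (by linarith)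
    have h2 : cE * (μ * L) ^ (-E) =
        (μ * L) ^ (-E) + (∑' j, ‖P j‖ ^ (-E)) * (μ * L / 2) ^ (-E) := by
      rw [div_rpow (by positivity) (by norm_num), rpow_neg (by norm_num : (0 : ℝ) ≤ 2),
        div_inv_eq_mul, hcE]
      ring
    linarith
  have hpow : (∑' j, (1 + μ * ‖y - xc L P x j‖) ^ (-E)) ^ (tS N - 2) ≤
      cE ^ (tS N - 2) * μ ^ (-2 : ℝ) := by
    refine (rpow_le_rpow (tsum_nonneg fun j => by positivity) hEsum (by linarith)).trans ?_
    rw [mul_rpow hcE0 (by positivity), ← rpow_mul (by positivity)]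
    refine mul_le_mul_of_nonneg_left ?_ (by positivity)
    have h1 : -E * (tS N - 2) ≤ -2 := by
      have : E * (tS N - 2) = ((N : ℝ) + 2) / 2 - τ := by rw [hE, e4]; field_simp
      linarith
    exact (rpow_le_rpow_of_exponent_le (hμ.trans hμL) h1).trans
      (rpow_le_rpow_of_nonpos hμ0 hμL (by norm_num))
  rw [wStarStar_eq N L P x hμ0, hσ, one_mul]
  rw [ell1_eq hN hs0 L P K x hμ0 (by rw [PU_eq hN hs L P x hμ0]; positivity),
    PU_eq hN hs L P x hμ0, Ub, mul_rpow hs0.le hp0, mul_rpow hs0.le hW.le, ← mul_sub]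
  set W := Wb N x μ y
  set PW := projW N k L P x μ y
  set S := ∑' j, Wb N x μ (y + L • P j)
  set SA := ∑' j, (1 + μ * ‖y - xc L P x j‖) ^ (-A)
  have hSA : 0 ≤ SA := tsum_nonneg fun j => by positivity
  have hq0 : 0 ≤ tS N - 1 := by linarith
  have hS0 : 0 ≤ S := hW.le.trans hWS
  have hK3 : |K y + 1 / 2| ≤ M + 1 / 2 := (abs_add_le _ _).trans (by
    rw [abs_of_pos (by norm_num : (0 : ℝ) < 1 / 2)]; linarith [hK0 y])
  have hP1 : PW ^ (tS N - 1) ≤ S ^ (tS N - 1) := rpow_le_rpow hp0 hp1 hq0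
  have hW1 : W ^ (tS N - 1) ≤ S ^ (tS N - 1) := rpow_le_rpow hW.le hWS hq0
  have hdiff : |PW ^ (tS N - 1) - W ^ (tS N - 1)| ≤ S ^ (tS N - 1) := by
    have h1 : 0 ≤ PW ^ (tS N - 1) := by positivity
    have h2 : 0 ≤ W ^ (tS N - 1) := by positivity
    rw [abs_le]; constructor <;> linarith
  have hSq : S ^ (tS N - 1) ≤ c1 ^ (tS N - 1) * (μ ^ (((N : ℝ) + 2) / 2) *
      (SA * (cE ^ (tS N - 2) * μ ^ (-2 : ℝ)))) := by
    refine (rpow_le_rpow hS0 hSD hq0).trans ?_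
    have h0 : 0 ≤ ∑' j, (1 + μ * ‖y - xc L P x j‖) ^ (-((N : ℝ) - 2)) :=
      tsum_nonneg fun j => by positivity
    rw [mul_rpow (by positivity) (by positivity), mul_rpow (by positivity) h0,
      ← rpow_mul hμ0.le]
    have e5 : ((N : ℝ) - 2) / 2 * (tS N - 1) = (N + 2) / 2 := by unfold tS; field_simp; ring
    rw [e5]
    gcongr
    exact hHol.trans (by gcongr)
  calc _ ≤ |K y + 1 / 2| * (s ^ (tS N - 1) * |PW ^ (tS N - 1) - W ^ (tS N - 1)|) +
        |K y - 1| * (s ^ (tS N - 1) * W ^ (tS N - 1)) := by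
        refine (abs_add_le _ _).trans_eq ?_
        simp only [abs_mul, abs_of_pos (rpow_pos_of_pos hs0 (tS N - 1)),
          abs_of_pos (rpow_pos_of_pos hW (tS N - 1))]
    _ ≤ (M + 1 / 2) * (s ^ (tS N - 1) * S ^ (tS N - 1)) +
        M * (s ^ (tS N - 1) * S ^ (tS N - 1)) := by
        gcongr
        exact hK1 y
    _ = (2 * M + 1 / 2) * s ^ (tS N - 1) * S ^ (tS N - 1) := by ring
    _ ≤ (2 * M + 1 / 2) * s ^ (tS N - 1) * (c1 ^ (tS N - 1) * (μ ^ (((N : ℝ) + 2) / 2) *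
      (SA * (cE ^ (tS N - 2) * μ ^ (-2 : ℝ))))) := by gcongr
    _ = _ := by rw [mul_rpow hs0.le (by positivity)]; ring

theorem exists_normStarStar_ell1_le {N k : ℕ} (hN : 5 ≤ N) (hk1 : 1 ≤ k)
    {K : Euc N → ℝ} {a b : Fin N → ℝ} {βm βM σ : ℝ}
    (hK : CondA N k K a b βm βM σ) {P : ℕ → Euc N} (hP : LatticeEnum N k P)
    {τ θ C0 β s : ℝ} (hτk : (k : ℝ) < τ) (hτN : τ < ((N : ℝ) - 2) / 2) (hθ : 0 < θ)
    (hC0 : 0 < C0) (hβ : (N : ℝ) - 2 < β) (hβm : β ≤ βm) (hs : SyncConst N s 1) :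
    ∃ C : ℝ, 0 ≤ C ∧ ∀ (L : ℝ) (x : Euc N) (μ : ℝ), Admissible N θ C0 β L x μ →
      normStarStar N k L P x μ τ (ell1 N k L P s 1 K x μ) ≤
        C * (μ ^ (-2 : ℝ) + (μ * ‖x‖) ^ β * μ ^ (-(β - τ + 1))) := by
  have hN' : (5 : ℝ) ≤ N := by exact_mod_cast hN
  obtain ⟨M, hM, hK0, hK1, hK2⟩ := hK.coefficient_bound (by linarith : 0 ≤ β) hβm
  obtain ⟨C1, hC1, h1⟩ := exists_inner_bound hN hk1 hP hτk hτN hθ hC0 hβ hs hM hK0 hK1 hK2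
  obtain ⟨C2, hC2, h2⟩ := exists_outer_bound (C0 := C0) (β := β) hN hk1 hP hτk hτN hθ hs hM
    hK0 hK1
  refine ⟨C1 + C2, by positivity, fun L x μ hadm => ?_⟩
  have hμ0 : 0 < μ := by linarith [hadm.1]
  have hx0 := norm_nonneg x
  have hR : 0 ≤ (μ * ‖x‖) ^ β * μ ^ (-(β - τ + 1)) := by positivity
  have hR2 : 0 ≤ μ ^ (-2 : ℝ) := by positivity
  refine Real.sSup_le ?_ (by positivity)
  rintro _ ⟨y, hy, rfl⟩
  have hw : 0 ≤ wStarStar N L P x μ τ y := by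
    rw [wStarStar_eq N L P x hμ0]
    exact mul_nonneg (σw_pos x y τ hμ0).le
      (mul_nonneg (by positivity) (tsum_nonneg fun j => by positivity))
  refine div_le_of_le_mul₀ hw (by positivity) ?_
  rcases le_or_gt ‖y‖ L with hyL | hyL
  · refine (h1 L x μ hadm y hy hyL).trans ?_
    gcongr
    linarith
  · refine (h2 L x μ hadm y hy hyL).trans ?_
    gcongr
    · linarith
    · linarith

/-- Lemma 4.3, the `**` norm of the error term `(ℓ₁,ℓ₂)`. -/
theorem lemma4_3
    (N k : ℕ) (hN : 5 ≤ N) (hk1 : 1 ≤ k) (hk2 : (k : ℝ) < ((N : ℝ) - 2) / 2)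
    (K1 K2 : Euc N → ℝ) (a1 a2 β1 β2 : Fin N → ℝ) (βm1 βM1 σ1 βm2 βM2 σ2 : ℝ)
    (hK1 : CondA N k K1 a1 β1 βm1 βM1 σ1) (hK2 : CondA N k K2 a2 β2 βm2 βM2 σ2)
    (s κ : ℝ) (hsκ : SyncConst N s κ)
    (P : ℕ → Euc N) (hP : LatticeEnum N k P)
    (τ : ℝ) (hτk : (k : ℝ) < τ) (hτN : τ < ((N : ℝ) - 2) / 2)
    (θ C0 : ℝ) (hθ : 0 < θ) (hC0 : 0 < C0) :
    ∃ C : ℝ, 0 < C ∧ ∀ (L : ℝ) (x : Euc N) (μ : ℝ),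
      Admissible N θ C0 (min βm1 βm2) L x μ →
      normStarStar N k L P x μ τ (ell1 N k L P s κ K1 x μ) +
          normStarStar N k L P x μ τ (ell2 N k L P s κ K2 x μ) ≤
        C * (1 / μ ^ (2 : ℝ) +
          (μ * ‖x‖) ^ (min βm1 βm2) / μ ^ (min βm1 βm2 - τ + 1)) := by
  obtain rfl := hsκ.kappa_eq_one hN
  have hβ : (N : ℝ) - 2 < min βm1 βm2 := by
    obtain ⟨i, hi⟩ := hK1.βm_mem
    obtain ⟨j, hj⟩ := hK2.βm_mem
    exact lt_min (hi ▸ hK1.β_gt i) (hj ▸ hK2.β_gt j)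
  obtain ⟨C1, hC1, h1⟩ := exists_normStarStar_ell1_le hN hk1 hK1 hP hτk hτN hθ hC0 hβ
    (min_le_left _ _) hsκ
  obtain ⟨C2, hC2, h2⟩ := exists_normStarStar_ell1_le hN hk1 hK2 hP hτk hτN hθ hC0 hβ
    (min_le_right _ _) hsκ
  refine ⟨C1 + C2 + 1, by positivity, fun L x μ hadm => ?_⟩
  have hμ0 : 0 < μ := by linarith [hadm.1]
  have hx0 := norm_nonneg x
  have e1 : 1 / μ ^ (2 : ℝ) + (μ * ‖x‖) ^ (min βm1 βm2) / μ ^ (min βm1 βm2 - τ + 1) =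
      μ ^ (-2 : ℝ) + (μ * ‖x‖) ^ (min βm1 βm2) * μ ^ (-(min βm1 βm2 - τ + 1)) := by
    rw [rpow_neg hμ0.le, rpow_neg hμ0.le, one_div, div_eq_mul_inv]
  rw [e1, ell2_one]
  have hR : 0 ≤ μ ^ (-2 : ℝ) +
      (μ * ‖x‖) ^ (min βm1 βm2) * μ ^ (-(min βm1 βm2 - τ + 1)) := by positivity
  linarith [h1 L x μ hadm, h2 L x μ hadm]

end PeriodicCriticalSystem
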